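/- arXiv:1703.08203 — 5 statements merged into one kernel-verified Lean document; each statement's English description precedes it below -/
import Mathlib

section
/- A local ring (R, 𝔪) is Henselian if and only if for every n and every n-tuple f = (f₁,…,fₙ) of polynomials in R[X₁,…,Xₙ] with f(0) ∈ 𝔪ⁿ and Jacobian determinant J satisfying J(0) ∈ R^×, there is a unique a ∈ 𝔪ⁿ with f(a) = 0. -/
open MvPolynomial IsLocalRing in
theorem residue_eval_aux {R : Type*} [CommRing R] [IsLocalRing R] {n : ℕ} (c : Fin n → R)
    (p : MvPolynomial (Fin n) R) :
    residue R (eval c p) = aeval (fun i => residue R (c i)) p := by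
  have := MvPolynomial.aeval_algebraMap_apply (ResidueField R) c p
  rw [ResidueField.algebraMap_eq] at this
  rw [← MvPolynomial.coe_aeval_eq_eval, RingHom.coe_coe, ← this]
  rfl

open IsLocalRing in
theorem etale_lift_aux {R S : Type*} [CommRing R] [HenselianLocalRing R] [CommRing S] [Algebra R S]
    [Algebra.Etale R S] (φ : S →ₐ[R] ResidueField R) :
    ∃ ψ : S →ₐ[R] R, ∀ s, residue R (ψ s) = φ s := by
  let Q : Ideal S := RingHom.ker φ
  have : Q.IsPrime := RingHom.ker_isPrime _
  obtain ⟨g, hg, hS⟩ := Algebra.IsEtaleAt.exists_isStandardEtale (R := R) Q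
  obtain ⟨P⟩ := hS.nonempty_standardEtalePresentation
  have hgu : IsUnit (φ g) := by
    rw [isUnit_iff_ne_zero]; exact hg
  let φ' : Localization.Away g →ₐ[R] ResidueField R :=
    IsLocalization.liftAlgHom (M := Submonoid.powers g) (f := φ) (by
      rintro ⟨_, n, rfl⟩
      simpa using hgu.pow n)
  have hφ' : ∀ s, φ' (algebraMap S _ s) = φ s := fun s => by simp [φ']
  have hx := P.hasMap.map φ'
  have hd := hx.isUnit_derivative_f
  have key : ∀ f : Polynomial R, f.Monic → ∀ a₀ : ResidueField R, Polynomial.aeval a₀ f = 0 →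
      Polynomial.aeval a₀ (Polynomial.derivative f) ≠ 0 →
      ∃ a : R, f.IsRoot a ∧ residue R a = a₀ :=
    by
    have H := (HenselianLocalRing.TFAE R).out 0 1
    exact H.mp inferInstance
  obtain ⟨a, ha, ha'⟩ := key P.f P.monic_f (φ' P.x) hx.1
    hd.ne_zero
  have hev : ∀ p : Polynomial R, Polynomial.aeval (φ' P.x) p = residue R (p.eval a) := fun p => by
    rw [← ha', ← ResidueField.algebraMap_eq, Polynomial.aeval_algebraMap_apply]
    simp
  have hm : P.HasMap a := by
    refine ⟨by simpa using ha, ?_⟩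
    have := hx.2
    rw [hev] at this
    simpa using isUnit_of_map_unit (residue R) _ this
  let ψ : Localization.Away g →ₐ[R] R := (P.lift a hm).comp P.equivRing.toAlgHom
  have hψ : (IsScalarTower.toAlgHom R R (ResidueField R)).comp ψ = φ' := by
    apply P.hom_ext
    simp [ψ, ha']
  refine ⟨ψ.comp (IsScalarTower.toAlgHom R S _), fun s => ?_⟩
  rw [← hφ', ← hψ]
  simp

open MvPolynomial IsLocalRing in
theorem exists_root_aux {R : Type*} [CommRing R] [HenselianLocalRing R]
    (n : ℕ) (f : Fin n → MvPolynomial (Fin n) R)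
    (h0 : ∀ i, MvPolynomial.eval (0 : Fin n → R) (f i) ∈ IsLocalRing.maximalIdeal R)
    (hJ : IsUnit (Matrix.det fun i j : Fin n =>
          MvPolynomial.eval (0 : Fin n → R) (MvPolynomial.pderiv j (f i)))) :
    ∃ a : Fin n → R, (∀ i, a i ∈ IsLocalRing.maximalIdeal R) ∧
          ∀ i, MvPolynomial.eval a (f i) = 0 := by
  have hres : ∀ p : MvPolynomial (Fin n) R, residue R (eval 0 p) = aeval 0 p := fun p => by
    have h : (fun i : Fin n => residue R ((0 : Fin n → R) i)) = 0 := by funext i; simp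
    rw [residue_eval_aux, h]
  let S₀ := MvPolynomial (Fin n) R ⧸ (Ideal.span (Set.range f))
  let P : Algebra.PreSubmersivePresentation R S₀ (Fin n) (Fin n) :=
    Algebra.PreSubmersivePresentation.naive (v := f) id Function.injective_id
  let S := Localization.Away P.jacobian
  let Q := (Algebra.PreSubmersivePresentation.localizationAway S P.jacobian).comp P
  have hQ : IsUnit Q.jacobian := by
    have : IsUnit (algebraMap S₀ S P.jacobian) := IsLocalization.Away.algebraMap_isUnit _
    rw [Algebra.PreSubmersivePresentation.comp_jacobian_eq_jacobian_smul_jacobian,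
      Algebra.PreSubmersivePresentation.localizationAway_jacobian, Algebra.smul_def]
    exact this.mul this
  have : Algebra.IsStandardSmoothOfRelativeDimension 0 R S := by
    refine Algebra.SubmersivePresentation.isStandardSmoothOfRelativeDimension
      (ι := Unit ⊕ Fin n) (σ := Unit ⊕ Fin n)
      { toPreSubmersivePresentation := Q, jacobian_isUnit := hQ } ?_
    simp [Algebra.Presentation.dimension]
  have : Algebra.Etale R S := inferInstance
  let φ₀ : S₀ →ₐ[R] ResidueField R := Ideal.Quotient.liftₐ _ (aeval (0 : Fin n → ResidueField R)) (by
    suffices Ideal.span (Set.range f) ≤ RingHom.ker (aeval (R := R) (0 : Fin n → ResidueField R)) from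
      fun a ha => this ha
    rw [Ideal.span_le]
    rintro _ ⟨i, rfl⟩
    change aeval 0 (f i) = 0
    rw [← hres, residue_eq_zero_iff]
    exact h0 i)
  have hmk : ∀ p : MvPolynomial (Fin n) R, φ₀ (Ideal.Quotient.mk _ p) = residue R (eval 0 p) :=
    fun p => (hres p).symm
  have hφ₀ : IsUnit (φ₀ P.jacobian) := by
    rw [Algebra.PreSubmersivePresentation.jacobian_eq_jacobiMatrix_det]
    change IsUnit (φ₀ (Ideal.Quotient.mk _ P.jacobiMatrix.det))
    rw [hmk]
    refine IsUnit.map _ ?_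
    let A₀ : Matrix (Fin n) (Fin n) R := Matrix.of fun i j => eval 0 (pderiv j (f i))
    change IsUnit A₀.det at hJ
    rw [← Matrix.det_transpose] at hJ
    convert hJ using 1
    refine (RingHom.map_det (eval (0 : Fin n → R)) P.jacobiMatrix).trans ?_
    congr 1
    ext i j
    have : P.jacobiMatrix i j = pderiv i (f j) :=
      Algebra.PreSubmersivePresentation.jacobiMatrix_apply P i j
    simp only [RingHom.mapMatrix_apply, Matrix.map_apply, Matrix.transpose_apply, A₀,
      Matrix.of_apply]
    rw [this]
  let φ : S →ₐ[R] ResidueField R :=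
    IsLocalization.liftAlgHom (M := Submonoid.powers P.jacobian) (f := φ₀) (by
      rintro ⟨_, n, rfl⟩
      simpa using hφ₀.pow n)
  obtain ⟨ψ, hψ⟩ := etale_lift_aux φ
  let q : MvPolynomial (Fin n) R →ₐ[R] S :=
    (IsScalarTower.toAlgHom R S₀ S).comp (Ideal.Quotient.mkₐ R _)
  refine ⟨fun i => ψ (q (X i)), fun i => ?_, fun i => ?_⟩
  · rw [← residue_eq_zero_iff, hψ]
    have : φ (q (X i)) = φ₀ (Ideal.Quotient.mk _ (X i)) := by
      simp [q, φ, S₀]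
    rw [this, hmk]
    simp
  · have h1 : aeval (fun i => ψ (q (X i))) = ψ.comp q := by
      ext i; simp
    have h2 : q (f i) = 0 := by
      have : Ideal.Quotient.mk (Ideal.span (Set.range f)) (f i) = 0 :=
        Ideal.Quotient.eq_zero_iff_mem.mpr (Ideal.subset_span ⟨i, rfl⟩)
      change algebraMap S₀ S (Ideal.Quotient.mk (Ideal.span (Set.range f)) (f i)) = 0
      rw [this, map_zero]
    rw [← MvPolynomial.coe_aeval_eq_eval, RingHom.coe_coe, h1]
    simp [h2]

open MvPolynomial in
theorem taylor_aux {R : Type*} [CommRing R] {n : ℕ} (p : MvPolynomial (Fin n) R) (a b : Fin n → R)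
    (I : Ideal R) (hI : ∀ i, b i - a i ∈ I) :
    eval b p - eval a p - ∑ j, eval a (pderiv j p) * (b j - a j) ∈ I ^ 2 := by
  induction p using MvPolynomial.induction_on with
  | C r => simp
  | add p q hp hq =>
    convert add_mem hp hq using 1
    simp only [map_add, add_mul, Finset.sum_add_distrib]
    ring
  | mul_X p i hp =>
    have h1 : eval b p - eval a p ∈ I := by
      have := Ideal.pow_le_self (two_ne_zero) hp
      have h2 : ∑ j, eval a (pderiv j p) * (b j - a j) ∈ I :=
        Ideal.sum_mem _ fun j _ => I.mul_mem_left _ (hI j)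
      simpa using add_mem this h2
    have h2 : (eval b p - eval a p) * (b i - a i) ∈ I ^ 2 := by
      rw [pow_two]; exact Ideal.mul_mem_mul h1 (hI i)
    convert add_mem h2 (Ideal.mul_mem_left _ (a i) hp) using 1
    have : ∑ j, eval a (pderiv j (p * X i)) * (b j - a j)
      = eval a p * (b i - a i) + a i * ∑ j, eval a (pderiv j p) * (b j - a j) := by
      rw [Finset.mul_sum]
      simp only [Derivation.leibniz, smul_eq_mul, map_add, map_mul, eval_X, add_mul,
        Finset.sum_add_distrib, pderiv_X]
      congr 1
      · rw [Finset.sum_eq_single i]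
        · simp
        · intro j _ hj; simp [hj.symm]
        · simp
      · exact Finset.sum_congr rfl fun j _ => by ring
    rw [this]
    simp only [map_mul, eval_X]
    ring

open MvPolynomial IsLocalRing in
theorem unique_root_aux {R : Type*} [CommRing R] [IsLocalRing R]
    (n : ℕ) (f : Fin n → MvPolynomial (Fin n) R)
    (hJ : IsUnit (Matrix.det fun i j : Fin n =>
          MvPolynomial.eval (0 : Fin n → R) (MvPolynomial.pderiv j (f i))))
    (a b : Fin n → R) (ha : ∀ i, a i ∈ IsLocalRing.maximalIdeal R)
    (hb : ∀ i, b i ∈ IsLocalRing.maximalIdeal R)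
    (ha' : ∀ i, MvPolynomial.eval a (f i) = 0) (hb' : ∀ i, MvPolynomial.eval b (f i) = 0) :
    b = a := by
  let I : Ideal R := Ideal.span (Set.range fun i => b i - a i)
  have hI : ∀ i, b i - a i ∈ I := fun i => Ideal.subset_span ⟨i, rfl⟩
  have hIm : I ≤ maximalIdeal R := by
    rw [Ideal.span_le]; rintro _ ⟨i, rfl⟩; exact sub_mem (hb i) (ha i)
  have hra : (fun i => residue R (a i)) = fun i => residue R ((0 : Fin n → R) i) := by
    funext i; simpa using ha i
  let A : Matrix (Fin n) (Fin n) R := Matrix.of fun i j => eval a (pderiv j (f i))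
  have hA : IsUnit A.det := by
    apply isUnit_of_map_unit (residue R)
    let A₀ : Matrix (Fin n) (Fin n) R := Matrix.of fun i j => eval 0 (pderiv j (f i))
    change IsUnit A₀.det at hJ
    convert hJ.map (residue R) using 1
    rw [RingHom.map_det, RingHom.map_det]
    congr 1
    ext i j
    simp only [RingHom.mapMatrix_apply, Matrix.map_apply, A]
    simp only [A₀, Matrix.of_apply]
    rw [residue_eval_aux, residue_eval_aux, hra]
  have h1 : ∀ i, (A.mulVec (b - a)) i ∈ I ^ 2 := fun i => by
    have := taylor_aux (f i) a b I hI
    rw [ha', hb'] at this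
    simpa [Matrix.mulVec, dotProduct, A] using this
  have h2 : I ≤ I ^ 2 := by
    refine Ideal.span_le.mpr ?_
    rintro _ ⟨i, rfl⟩
    have : (b - a) = A⁻¹.mulVec (A.mulVec (b - a)) := by
      rw [Matrix.mulVec_mulVec, Matrix.nonsing_inv_mul _ hA, Matrix.one_mulVec]
    change (b - a) i ∈ I ^ 2
    rw [this]
    simp only [Matrix.mulVec.eq_1 A⁻¹, dotProduct]
    exact Ideal.sum_mem _ fun j _ => Ideal.mul_mem_left _ (A⁻¹ i j) (h1 j)
  have h3 : I = ⊥ := by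
    refine Submodule.eq_bot_of_le_smul_of_le_jacobson_bot (maximalIdeal R) I ?_ ?_ ?_
    · exact Submodule.fg_span (Set.finite_range _)
    · rw [pow_two] at h2
      exact h2.trans (Ideal.mul_mono_left hIm)
    · exact (IsLocalRing.jacobson_eq_maximalIdeal ⊥ bot_ne_top).ge
  funext i
  have := hI i
  rw [h3] at this
  exact sub_eq_zero.mp this

/-- A local ring `(R, 𝔪)` is Henselian iff for every `n`-tuple `f` of polynomials in
`n` variables over `R` with `f(0) ∈ 𝔪ⁿ` and Jacobian determinant at `0` a unit, there is
a unique `a ∈ 𝔪ⁿ` with `f(a) = 0`. -/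
theorem henselianLocalRing_iff_tuple_hensel
    {R : Type*} [CommRing R] [IsLocalRing R] :
    HenselianLocalRing R ↔
      ∀ (n : ℕ) (f : Fin n → MvPolynomial (Fin n) R),
        (∀ i, MvPolynomial.eval (0 : Fin n → R) (f i) ∈ IsLocalRing.maximalIdeal R) →
        IsUnit (Matrix.det fun i j : Fin n =>
          MvPolynomial.eval (0 : Fin n → R) (MvPolynomial.pderiv j (f i))) →
        ∃! a : Fin n → R, (∀ i, a i ∈ IsLocalRing.maximalIdeal R) ∧
          ∀ i, MvPolynomial.eval a (f i) = 0 := by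
  constructor
  · intro H n f h0 hJ
    obtain ⟨a, ha, ha'⟩ := exists_root_aux n f h0 hJ
    exact ⟨a, ⟨ha, ha'⟩, fun b hb => unique_root_aux n f hJ a b ha hb.1 ha' hb.2⟩
  · intro H
    refine ⟨fun f _ a₀ h₁ h₂ => ?_⟩
    let g : MvPolynomial (Fin 1) R := Polynomial.aeval (MvPolynomial.X 0 + MvPolynomial.C a₀) f
    have hev : ∀ (p : Polynomial R) (c : Fin 1 → R), MvPolynomial.eval c
        (Polynomial.aeval (MvPolynomial.X 0 + MvPolynomial.C a₀) p) = p.eval (c 0 + a₀) := by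
      intro p c
      rw [← MvPolynomial.coe_aeval_eq_eval, RingHom.coe_coe, ← Polynomial.aeval_algHom_apply]
      simp
    have hd : MvPolynomial.pderiv 0 g =
        Polynomial.aeval (MvPolynomial.X 0 + MvPolynomial.C a₀) f.derivative := by
      simp only [g]
      rw [Derivation.map_aeval]
      simp
    obtain ⟨a, ⟨ha, ha'⟩, -⟩ := H 1 (fun _ => g) (fun i => by
        rw [hev]; simpa using h₁)
      (by
        let A : Matrix (Fin 1) (Fin 1) R :=
          Matrix.of fun _ j => MvPolynomial.eval 0 (MvPolynomial.pderiv j g)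
        change IsUnit A.det
        rw [Matrix.det_fin_one]
        simp only [A, Matrix.of_apply]
        rw [hd, hev]
        simpa using h₂)
    refine ⟨a 0 + a₀, ?_, by simpa using ha 0⟩
    have := ha' 0
    simpa [g, hev] using this
end

section
/- Let (R, 𝔪) be a Henselian local ring and f = (f₁,…,fₙ) an n-tuple of polynomials in R[X₁,…,Xₙ] with f(0) ∈ 𝔪ⁿ and Jacobian determinant J(0) ∈ R^×. Then f restricts to a bijection of 𝔪ⁿ onto itself which is a homeomorphism in the 𝔪-adic topology. -/
open MvPolynomial in
lemma hpt_taylor {R : Type*} [CommRing R] (I : Ideal R) {n : ℕ} (p : MvPolynomial (Fin n) R)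
    (x y : Fin n → R) (hx : ∀ i, x i ∈ I) (hy : ∀ i, y i ∈ I) :
    ∃ c : Fin n → R, eval x p - eval y p = ∑ j, c j * (x j - y j) ∧
      ∀ j, c j - eval 0 (pderiv j p) ∈ I := by
  have key : ∀ (q : MvPolynomial (Fin n) R) (z : Fin n → R), (∀ i, z i ∈ I) →
      eval z q - eval 0 q ∈ I := by
    intro q z hz
    rw [← Ideal.Quotient.eq_zero_iff_mem, map_sub, sub_eq_zero]
    have : (Ideal.Quotient.mk I).comp (eval z) = (Ideal.Quotient.mk I).comp (eval 0) := by
      apply MvPolynomial.ringHom_ext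
      · intro r; simp
      · intro i; simpa using Ideal.Quotient.eq_zero_iff_mem.mpr (hz i)
    exact congr($this q)
  induction p using MvPolynomial.induction_on with
  | C a => exact ⟨0, by simp, by simp⟩
  | add p q hp hq =>
    obtain ⟨c, h1, h2⟩ := hp
    obtain ⟨d, h3, h4⟩ := hq
    refine ⟨c + d, ?_, fun j => ?_⟩
    · simp only [map_add, Pi.add_apply, add_mul, Finset.sum_add_distrib, ← h1, ← h3]; ring
    · have := I.add_mem (h2 j) (h4 j)
      simp only [map_add, Pi.add_apply]
      convert this using 1; ring
  | mul_X p i hp =>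
    obtain ⟨c, h1, h2⟩ := hp
    refine ⟨fun j => c j * x i + (if j = i then eval y p else 0), ?_, fun j => ?_⟩
    · simp only [add_mul, Finset.sum_add_distrib, ite_mul, zero_mul, Finset.sum_ite_eq', 
        Finset.mem_univ, if_true, map_mul, eval_X]
      rw [show ∑ j, c j * x i * (x j - y j) = (∑ j, c j * (x j - y j)) * x i by
        rw [Finset.sum_mul]; exact Finset.sum_congr rfl fun _ _ => by ring, ← h1]
      ring
    · have h3 := I.mul_mem_left (c j) (hx i)
      by_cases hji : j = i
      · subst hji
        have := I.add_mem h3 (key p y hy)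
        simpa [pderiv_X, add_sub_assoc] using this
      · simpa [pderiv_X, hji] using h3

lemma hpt_inv {R : Type*} [CommRing R] [IsLocalRing R]
    {n : ℕ} (f : Fin n → MvPolynomial (Fin n) R)
    (hJ : IsUnit (Matrix.det <| Matrix.of fun i j : Fin n =>
      MvPolynomial.eval (0 : Fin n → R) (MvPolynomial.pderiv j (f i))))
    (x y : Fin n → R) (hx : ∀ i, x i ∈ IsLocalRing.maximalIdeal R)
    (hy : ∀ i, y i ∈ IsLocalRing.maximalIdeal R) :
    ∃ N : Matrix (Fin n) (Fin n) R, x - y =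
      N.mulVec (fun i => MvPolynomial.eval x (f i) - MvPolynomial.eval y (f i)) := by
  choose c h1 h2 using fun i => hpt_taylor (IsLocalRing.maximalIdeal R) (f i) x y hx hy
  have hdet : IsUnit (Matrix.det (Matrix.of c)) := by
    rw [← isUnit_map_iff (IsLocalRing.residue R)] at hJ ⊢
    rw [RingHom.map_det] at hJ ⊢
    convert hJ using 2
    ext i j
    have := h2 i j
    rw [← IsLocalRing.residue_eq_zero_iff, map_sub, sub_eq_zero] at this
    exact this
  refine ⟨(Matrix.of c)⁻¹, ?_⟩
  have : (fun i => MvPolynomial.eval x (f i) - MvPolynomial.eval y (f i)) =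
      (Matrix.of c).mulVec (x - y) := by
    ext i; rw [h1]; simp [Matrix.mulVec, dotProduct]
  rw [this, Matrix.mulVec_mulVec, Matrix.nonsing_inv_mul _ hdet, Matrix.one_mulVec]

lemma hpt_lift {R T : Type*} [CommRing R] [HenselianLocalRing R] [CommRing T] [Algebra R T]
    [Algebra.Etale R T] (φ : T →ₐ[R] IsLocalRing.ResidueField R) :
    ∃ ψ : T →ₐ[R] R, ∀ t, IsLocalRing.residue R (ψ t) = φ t := by
  have : (RingHom.ker φ).IsPrime := RingHom.ker_isPrime _
  obtain ⟨f, hf, ⟨⟨P⟩⟩⟩ := Algebra.IsEtaleAt.exists_isStandardEtale (R := R) (RingHom.ker φ)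
  have hfu : IsUnit (φ f) := isUnit_iff_ne_zero.mpr hf
  let φ' : Localization.Away f →ₐ[R] IsLocalRing.ResidueField R :=
    IsLocalization.Away.liftAlgHom f (f := φ) hfu
  obtain ⟨a₀, ha₀⟩ := IsLocalRing.residue_surjective (φ' P.x)
  have hm := P.hasMap.map φ'
  have hev : ∀ (p : Polynomial R) (a : R), Polynomial.aeval (IsLocalRing.residue R a) p
      = IsLocalRing.residue R (p.eval a) := by
    intro p a
    exact Polynomial.aeval_algebraMap_apply_eq_algebraMap_eval a p
  have hd := hm.isUnit_derivative_f
  obtain ⟨a, ha, haa⟩ := HenselianLocalRing.is_henselian P.f P.monic_f a₀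
    (by rw [← IsLocalRing.residue_eq_zero_iff, ← hev, ha₀]; exact hm.1)
    (by rw [← isUnit_map_iff (IsLocalRing.residue R), ← hev, ha₀]; exact hd)
  have hra : IsLocalRing.residue R a = φ' P.x := by
    rw [← IsLocalRing.residue_eq_zero_iff, map_sub, sub_eq_zero, ha₀] at haa
    exact haa
  have hma : P.HasMap a := ⟨by simpa using ha, by
    have := hm.2
    rw [← hra, hev, isUnit_map_iff] at this
    simpa using this⟩
  let ψ : Localization.Away f →ₐ[R] R := (P.lift a hma).comp P.equivRing.toAlgHom
  have hψ : (Algebra.ofId R (IsLocalRing.ResidueField R)).comp ψ = φ' := by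
    apply P.hom_ext
    simpa [ψ] using hra
  refine ⟨ψ.comp (IsScalarTower.toAlgHom R T _), fun t => ?_⟩
  have := congr($hψ (algebraMap T _ t))
  simpa [φ'] using this

open MvPolynomial in
lemma hpt_etale {R : Type*} [CommRing R] {n : ℕ} (g : Fin n → MvPolynomial (Fin n) R) :
    Algebra.Etale R (Localization.Away (Ideal.Quotient.mk (Ideal.span (Set.range g))
      (Matrix.det <| Matrix.of fun i j : Fin n => pderiv j (g i)))) := by
  set S := MvPolynomial (Fin n) R ⧸ (Ideal.span (Set.range g))
  set J : S := Ideal.Quotient.mk (Ideal.span (Set.range g))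
      (Matrix.det <| Matrix.of fun i j : Fin n => pderiv j (g i)) with hJ
  let P := Algebra.PreSubmersivePresentation.naive (v := g) id Function.injective_id
  let Q := (Algebra.SubmersivePresentation.localizationAway (Localization.Away J) J)
  have hP : P.jacobian = J := by
    rw [Algebra.PreSubmersivePresentation.jacobian_eq_jacobiMatrix_det, hJ]
    rw [← Matrix.det_transpose (Matrix.of _)]
    have : P.jacobiMatrix = (Matrix.of fun i j : Fin n => pderiv j (g i)).transpose := by
      ext1 i j
      exact Algebra.PreSubmersivePresentation.jacobiMatrix_naive _ _ _ _ i j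
    rw [this]
    rw [P.algebraMap_eq]
    have h2 : aeval P.val = Ideal.Quotient.mkₐ R (Ideal.span (Set.range g)) := by
      ext i
      simp [P]
    exact congr($h2 _)
  let C : Algebra.SubmersivePresentation R (Localization.Away J) _ _ :=
    { Q.toPreSubmersivePresentation.comp P with
      jacobian_isUnit := by
        rw [Algebra.PreSubmersivePresentation.comp_jacobian_eq_jacobian_smul_jacobian,
          Algebra.smul_def, IsUnit.mul_iff, hP]
        exact ⟨IsLocalization.Away.algebraMap_isUnit J, Q.jacobian_isUnit⟩ }
  have : Algebra.IsStandardSmoothOfRelativeDimension 0 R (Localization.Away J) :=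
    C.isStandardSmoothOfRelativeDimension (by simp [Algebra.Presentation.dimension])
  infer_instance
  
open MvPolynomial in
lemma hpt_surj {R : Type*} [CommRing R] [HenselianLocalRing R]
    {n : ℕ} (g : Fin n → MvPolynomial (Fin n) R)
    (hf0 : ∀ i, eval (0 : Fin n → R) (g i) ∈ IsLocalRing.maximalIdeal R)
    (hJ : IsUnit (Matrix.det <| Matrix.of fun i j : Fin n =>
      eval (0 : Fin n → R) (pderiv j (g i)))) :
    ∃ x : Fin n → R, (∀ i, x i ∈ IsLocalRing.maximalIdeal R) ∧ ∀ i, eval x (g i) = 0 := by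
  have := hpt_etale g
  let φ₀ : MvPolynomial (Fin n) R →ₐ[R] IsLocalRing.ResidueField R := aeval 0
  have hφ₀ : ∀ p, φ₀ p = IsLocalRing.residue R (eval 0 p) := by
    intro p
    have : φ₀ = (Algebra.ofId R (IsLocalRing.ResidueField R)).comp (aeval 0) := by
      ext; simp [φ₀]
    rw [this]; rfl
  let φ₁ : (MvPolynomial (Fin n) R ⧸ (Ideal.span (Set.range g))) →ₐ[R] IsLocalRing.ResidueField R :=
    Ideal.Quotient.liftₐ _ φ₀ (by
      intro a ha
      have : Ideal.span (Set.range g) ≤ RingHom.ker φ₀ := by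
        rw [Ideal.span_le]
        rintro _ ⟨i, rfl⟩
        simp only [SetLike.mem_coe, RingHom.mem_ker]
        rw [hφ₀, IsLocalRing.residue_eq_zero_iff]
        exact hf0 i
      exact this ha)
  let φ := IsLocalization.Away.liftAlgHom (S := Localization.Away (Ideal.Quotient.mk (Ideal.span (Set.range g))
      (Matrix.det <| Matrix.of fun i j : Fin n => pderiv j (g i)))) (Ideal.Quotient.mk (Ideal.span (Set.range g))
      (Matrix.det <| Matrix.of fun i j : Fin n => pderiv j (g i))) (f := φ₁) (by
        change IsUnit (φ₀ _)
        rw [hφ₀, RingHom.map_det]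
        exact hJ.map _)
  obtain ⟨ψ, hψ⟩ := hpt_lift φ
  let χ : MvPolynomial (Fin n) R →ₐ[R] R := 
    (ψ.comp (IsScalarTower.toAlgHom R (MvPolynomial (Fin n) R ⧸ (Ideal.span (Set.range g))) _)).comp
      (Ideal.Quotient.mkₐ R _)
  have hχ : ∀ p, χ p = eval (fun i => χ (X i)) p := by
    intro p
    have : χ = aeval (fun i => χ (X i)) := by ext; simp
    conv_lhs => rw [this]
    rfl
  refine ⟨fun i => χ (X i), fun i => ?_, fun i => ?_⟩
  · rw [← IsLocalRing.residue_eq_zero_iff]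
    have : φ₀ (X i) = 0 := by simp [φ₀]
    rw [← this]
    refine (hψ _).trans ?_
    simp only [φ, IsScalarTower.coe_toAlgHom', IsLocalization.Away.liftAlgHom_apply,
      RingHom.coe_coe, IsLocalization.Away.lift_eq]
    rfl
  · rw [← hχ]
    have : Ideal.Quotient.mk (Ideal.span (Set.range g)) (g i) = 0 :=
      Ideal.Quotient.eq_zero_iff_mem.mpr (Ideal.subset_span ⟨i, rfl⟩)
    simp [χ, this]


/-- Over a Henselian local ring `(R, 𝔪)`, an `n`-tuple `f` of polynomials with
`f(0) ∈ 𝔪ⁿ` and Jacobian determinant at `0` a unit restricts to a bijection of `𝔪ⁿ`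
onto itself which is a homeomorphism for the `𝔪`-adic topology. -/
theorem henselian_polynomial_tuple_bijOn_and_adic_homeomorph
    {R : Type*} [CommRing R] [HenselianLocalRing R]
    {n : ℕ} (f : Fin n → MvPolynomial (Fin n) R)
    (hf0 : ∀ i, MvPolynomial.eval (0 : Fin n → R) (f i) ∈ IsLocalRing.maximalIdeal R)
    (hJ : IsUnit (Matrix.det fun i j : Fin n =>
      MvPolynomial.eval (0 : Fin n → R) (MvPolynomial.pderiv j (f i)))) :
    Set.BijOn (fun x (i : Fin n) => MvPolynomial.eval x (f i))
      {x : Fin n → R | ∀ i, x i ∈ IsLocalRing.maximalIdeal R}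
      {x : Fin n → R | ∀ i, x i ∈ IsLocalRing.maximalIdeal R} ∧
    (letI : TopologicalSpace R := (IsLocalRing.maximalIdeal R).adicTopology
     ∃ F : {x : Fin n → R // ∀ i, x i ∈ IsLocalRing.maximalIdeal R} ≃ₜ
           {x : Fin n → R // ∀ i, x i ∈ IsLocalRing.maximalIdeal R},
       ∀ x (i : Fin n), (F x : Fin n → R) i = MvPolynomial.eval (x : Fin n → R) (f i)) := by
  have hbij : Set.BijOn (fun x (i : Fin n) => MvPolynomial.eval x (f i))
      {x : Fin n → R | ∀ i, x i ∈ IsLocalRing.maximalIdeal R}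
      {x : Fin n → R | ∀ i, x i ∈ IsLocalRing.maximalIdeal R} := by
    refine ⟨fun x hx i => ?_, fun x hx y hy hxy => ?_, fun y hy => ?_⟩
    · obtain ⟨c, h1, -⟩ := hpt_taylor (IsLocalRing.maximalIdeal R) (f i) x 0 hx (by simp)
      have : MvPolynomial.eval x (f i) =
          MvPolynomial.eval 0 (f i) + ∑ j, c j * (x j - (0 : Fin n → R) j) := by
        rw [← h1]; ring
      change MvPolynomial.eval x (f i) ∈ _
      rw [this]
      refine Ideal.add_mem _ (hf0 i) (Ideal.sum_mem _ fun j _ => Ideal.mul_mem_left _ _ ?_)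
      simpa using hx j
    · obtain ⟨N, hN⟩ := hpt_inv f hJ x y hx hy
      rw [← sub_eq_zero, hN]
      have : (fun i => MvPolynomial.eval x (f i) - MvPolynomial.eval y (f i)) = 0 := by
        ext i; exact sub_eq_zero.mpr (congrFun hxy i)
      rw [this, Matrix.mulVec_zero]
    · obtain ⟨x, hx, h⟩ := hpt_surj (fun i => f i - MvPolynomial.C (y i))
        (fun i => by simpa using Ideal.sub_mem _ (hf0 i) (hy i)) (by
          simp only [map_sub, MvPolynomial.pderiv_C, sub_zero]; exact hJ)
      refine ⟨x, hx, ?_⟩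
      ext i
      simpa [sub_eq_zero] using h i
  refine ⟨hbij, ?_⟩
  let _ : TopologicalSpace R := (IsLocalRing.maximalIdeal R).adicTopology
  have : NonarchimedeanRing R := (IsLocalRing.maximalIdeal R).nonarchimedean
  let e : {x : Fin n → R // ∀ i, x i ∈ IsLocalRing.maximalIdeal R} ≃
           {x : Fin n → R // ∀ i, x i ∈ IsLocalRing.maximalIdeal R} := Set.BijOn.equiv _ hbij
  have he : ∀ x (i : Fin n), (e x : Fin n → R) i = MvPolynomial.eval (x : Fin n → R) (f i) :=
    fun x i => rfl
  refine ⟨⟨e, ?_, ?_⟩, he⟩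
  · refine Continuous.subtype_mk (continuous_pi fun i => ?_) _
    exact (MvPolynomial.continuous_eval (f i)).comp continuous_subtype_val
  · change Continuous e.symm
    rw [continuous_iff_continuousAt]
    intro y
    refine Topology.IsInducing.subtypeVal.continuousAt_iff.mpr (continuousAt_pi.mpr ?_)
    intro i
    rw [ContinuousAt, ((IsLocalRing.maximalIdeal R).hasBasis_nhds_adic _).tendsto_right_iff]
    intro k _
    have hk : ∀ᶠ z : {x : Fin n → R // ∀ i, x i ∈ IsLocalRing.maximalIdeal R} in nhds y,
        ∀ j, z.1 j - y.1 j ∈ (IsLocalRing.maximalIdeal R) ^ k := by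
      rw [Filter.eventually_all]
      intro j
      have hc : Continuous fun z : {x : Fin n → R // ∀ i, x i ∈ IsLocalRing.maximalIdeal R} =>
          z.1 j - y.1 j :=
        ((continuous_apply j).comp continuous_subtype_val).sub continuous_const
      have := hc.tendsto y
      rw [sub_self] at this
      exact this.eventually
        ((IsLocalRing.maximalIdeal R).hasBasis_nhds_zero_adic.mem_of_mem (i := k) trivial)
    filter_upwards [hk] with z hz
    obtain ⟨N, hN⟩ := hpt_inv f hJ (e.symm z).1 (e.symm y).1 (e.symm z).2 (e.symm y).2
    refine ⟨(e.symm z).1 i - (e.symm y).1 i, ?_, by simp⟩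
    have := congrFun hN i
    rw [Pi.sub_apply] at this
    rw [this]
    change (∑ j, N i j * (MvPolynomial.eval (e.symm z).1 (f j) -
      MvPolynomial.eval (e.symm y).1 (f j))) ∈ (IsLocalRing.maximalIdeal R) ^ k
    refine Ideal.sum_mem _ fun j _ => Ideal.mul_mem_left _ _ ?_
    rw [← he, ← he, e.apply_symm_apply, e.apply_symm_apply]
    exact hz j
end

section
/- Let (R, 𝔪) be a Henselian local domain, 0 ≤ r < n, and p = (p_{r+1},…,pₙ) an (n−r)-tuple of polynomials in R[X₁,…,Xₙ] vanishing at the origin. Suppose e := det(∂p_i/∂X_j)(0) (i, j = r+1,…,n) is nonzero. Then there exists a map φ : (e²𝔪)^r → (e𝔪)^{n−r} with φ(0) = 0 such that for every u ∈ (e²𝔪)^r, p_i(u, φ(u)) = 0 for all i = r+1,…,n, and the graph map u ↦ (u, φ(u)) is injective. -/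
/-- Glue a point of `R^r` and a point of `R^(n-r)` into a point of `R^n`. -/
def glueCoords {R : Type*} (r n : ℕ) (u : Fin r → R) (v : Fin (n - r) → R) : Fin n → R :=
  fun i => if hi : (i : ℕ) < r then u ⟨i, hi⟩ else v ⟨(i : ℕ) - r, by omega⟩

theorem idx_aux {r n : ℕ} (j : Fin (n - r)) : r + (j : ℕ) < n :=
  Nat.add_lt_of_lt_sub' j.isLt

open IsLocalRing in
theorem mvHensel_aux {R : Type*} [CommRing R] [HenselianLocalRing R] {k : ℕ}
    (F : Fin k → MvPolynomial (Fin k) R)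
    (h0 : ∀ i, MvPolynomial.eval 0 (F i) ∈ maximalIdeal R)
    (hd : IsUnit (Matrix.det fun i j : Fin k =>
      MvPolynomial.eval (0 : Fin k → R) (MvPolynomial.pderiv j (F i)))) :
    ∃ y : Fin k → R, (∀ j, y j ∈ maximalIdeal R) ∧ ∀ i, MvPolynomial.eval y (F i) = 0 := by
  let S := MvPolynomial (Fin k) R ⧸ (Ideal.span <| Set.range F)
  let P : Algebra.PreSubmersivePresentation R S (Fin k) (Fin k) :=
    .naive (v := F) id Function.injective_id
  let Δ : S := P.jacobian
  let T := Localization.Away Δ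
  have hΔ : IsUnit (algebraMap S T Δ) := IsLocalization.Away.algebraMap_isUnit _
  have etale : Algebra.Etale R T := by
    let P' : Algebra.SubmersivePresentation R T _ _ :=
      { toPreSubmersivePresentation :=
          .comp (.localizationAway T Δ) P,
        jacobian_isUnit := by simpa [Algebra.smul_def, -isUnit_map_iff, hΔ] }
    have : Algebra.IsStandardSmoothOfRelativeDimension 0 R T :=
      ⟨_, _, _, inferInstance, P', by
        simp only [Algebra.PreSubmersivePresentation.dimension_comp_eq_dimension_add_dimension, P']
        simp [Algebra.Presentation.dimension]⟩
    infer_instance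
  let κ := ResidueField R
  have ev : ∀ q : MvPolynomial (Fin k) R,
      MvPolynomial.aeval (0 : Fin k → κ) q = residue R (MvPolynomial.eval 0 q) := by
    intro q
    have h := MvPolynomial.aeval_algebraMap_apply κ (0 : Fin k → R) q
    have h2 : (algebraMap R κ ∘ (0 : Fin k → R)) = 0 := by ext; simp
    rw [h2] at h
    rw [h]
    simp
    rfl
  let θ₀ : S →ₐ[R] κ := Ideal.Quotient.liftₐ _ (MvPolynomial.aeval (0 : Fin k → κ)) (by
    intro a ha
    refine (Ideal.span_le (I := RingHom.ker (MvPolynomial.aeval (R := R) (0 : Fin k → κ)))).mpr ?_ ha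
    rintro _ ⟨i, rfl⟩
    change MvPolynomial.aeval (0 : Fin k → κ) (F i) = 0
    rw [ev]
    exact (residue_eq_zero_iff _).mpr (h0 i))
  have hθ₀ : ∀ q, θ₀ (Ideal.Quotient.mk _ q) = residue R (MvPolynomial.eval 0 q) := by
    intro q
    rw [← ev]
    rfl
  have hθΔ : IsUnit (θ₀ Δ) := by
    have : Δ = Ideal.Quotient.mk _ P.jacobiMatrix.det := P.jacobian_eq_jacobiMatrix_det
    rw [this, hθ₀]
    apply IsUnit.map
    rw [RingHom.map_det]
    convert! hd using 1
    rw [← Matrix.det_transpose]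
    congr 1
    ext i j
    have : P.jacobiMatrix j i = MvPolynomial.pderiv j (F i) :=
      Algebra.PreSubmersivePresentation.jacobiMatrix_naive (v := F) id Function.injective_id _ _ j i
    rw [Matrix.transpose_apply, RingHom.mapMatrix_apply, Matrix.map_apply, this]
  let θ : T →ₐ[R] κ := IsLocalization.liftAlgHom (M := Submonoid.powers Δ) (f := θ₀) (by
    rintro ⟨_, n, rfl⟩
    simpa using hθΔ.pow n)
  have hθ : ∀ s, θ (algebraMap S T s) = θ₀ s := fun s => by simp [θ]
  let Q : Ideal T := RingHom.ker θ
  have : Q.IsPrime := RingHom.ker_isPrime θ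
  obtain ⟨f, hf, hst⟩ := Algebra.IsEtaleAt.exists_isStandardEtale (R := R) Q
  let U := Localization.Away f
  let θ' : U →ₐ[R] κ := IsLocalization.liftAlgHom (M := Submonoid.powers f) (f := θ) (by
    rintro ⟨_, n, rfl⟩
    have : θ f ≠ 0 := hf
    have h2 := (IsUnit.mk0 _ this).pow n
    rw [← map_pow] at h2
    exact h2)
  have hθ' : ∀ s, θ' (algebraMap T U s) = θ s := fun s => by simp [θ']
  obtain ⟨Pr⟩ : Nonempty (StandardEtalePresentation R U) := hst.nonempty_standardEtalePresentation
  have hm := Pr.hasMap.map θ'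
  have hm' := hm.isUnit_derivative_f
  have H := ((HenselianLocalRing.TFAE R).out 0 1).mp ‹HenselianLocalRing R›
  obtain ⟨a, ha, hra⟩ := H Pr.f Pr.monic_f
    (θ' Pr.x) hm.1 hm'.ne_zero
  have hres : ∀ q : Polynomial R, Polynomial.aeval (θ' Pr.x) q = residue R (Polynomial.aeval a q) := by
    intro q
    rw [← hra]
    exact Polynomial.aeval_algebraMap_apply κ a q
  have hma : Pr.P.HasMap a := by
    refine ⟨by simpa using ha, ?_⟩
    have h := hm.2
    rw [hres] at h
    exact isUnit_of_map_unit _ _ h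
  let s : U →ₐ[R] R := (Pr.P.lift a hma).comp Pr.equivRing.toAlgHom
  have hs : (Algebra.ofId R κ).comp s = θ' := by
    apply Pr.hom_ext
    simp [s, Algebra.ofId_apply]
    exact hra
  let g : MvPolynomial (Fin k) R →ₐ[R] R :=
    s.comp ((IsScalarTower.toAlgHom R T U).comp ((IsScalarTower.toAlgHom R S T).comp
      (Ideal.Quotient.mkₐ R _)))
  have hg : g = MvPolynomial.aeval (fun i => g (.X i)) := MvPolynomial.aeval_unique g
  refine ⟨fun i => g (.X i), fun j => ?_, fun i => ?_⟩
  · have h1 : residue R (g (.X j)) = θ' (algebraMap T U (algebraMap S T (Ideal.Quotient.mk _ (.X j)))) := by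
      rw [← hs]; rfl
    rw [hθ', hθ, hθ₀] at h1
    simpa using h1
  · have h1 := DFunLike.congr_fun hg (F i)
    rw [MvPolynomial.aeval_eq_eval] at h1
    refine Eq.trans h1.symm ?_
    have : Ideal.Quotient.mkₐ R (Ideal.span <| Set.range F) (F i) = 0 :=
      Ideal.Quotient.eq_zero_iff_mem.mpr (Ideal.subset_span ⟨i, rfl⟩)
    simp only [g, AlgHom.comp_apply, this, map_zero]

open MvPolynomial in
theorem scale_aux {R σ : Type*} [CommRing R] [Fintype σ] [DecidableEq σ] (e : R)
    (P : MvPolynomial σ R) :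
    ∃ Q : MvPolynomial σ R, (∀ x : σ → R, eval (fun i => e * x i) P = eval 0 P +
      e * ∑ i, eval 0 (pderiv i P) * x i + e ^ 2 * eval x Q) ∧ eval 0 Q = 0 ∧
      ∀ i, eval 0 (pderiv i Q) = 0 := by
  induction P using MvPolynomial.induction_on with
  | C a => exact ⟨0, by simp⟩
  | add p q hp hq =>
    obtain ⟨Q, h1, h2, h3⟩ := hp
    obtain ⟨Q', h1', h2', h3'⟩ := hq
    refine ⟨Q + Q', fun x => ?_, by rw [map_add, h2, h2', add_zero],
      fun i => by rw [map_add, map_add, h3, h3', add_zero]⟩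
    simp only [map_add, h1, h1', add_mul, Finset.sum_add_distrib]
    ring
  | mul_X p j hp =>
    obtain ⟨Q, h1, h2, h3⟩ := hp
    refine ⟨(∑ i, C (eval 0 (pderiv i p)) * X i) * X j + C e * Q * X j, fun x => ?_, by simp, ?_⟩
    · have h4 : ∀ i, eval 0 (pderiv i (p * X j)) * x i = if i = j then eval 0 p * x i else 0 := by
        intro i
        split_ifs with h
        · subst h; simp
        · rw [Derivation.leibniz, pderiv_X_of_ne (Ne.symm h)]; simp
      simp only [h4]
      rw [Finset.sum_ite_eq' Finset.univ j]
      simp only [map_add, map_mul, h1, eval_X, map_sum, eval_C, Finset.mem_univ, if_true,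
        Pi.zero_apply]
      ring
    · intro i
      rw [map_add, Derivation.leibniz, Derivation.leibniz]
      simp only [map_add, smul_eq_mul, map_mul, h2, map_sum, eval_X, Pi.zero_apply, mul_zero,
        zero_mul, Finset.sum_const_zero, add_zero]

open MvPolynomial in
theorem chain_aux {R : Type*} [CommRing R] {r n : ℕ} (c : Fin r → R) (j : Fin (n - r))
    (hj : r + (j : ℕ) < n) (Q : MvPolynomial (Fin n) R) :
    pderiv j (aeval (glueCoords r n (fun i => C (c i)) X : Fin n → MvPolynomial (Fin (n-r)) R) Q) =
    aeval (glueCoords r n (fun i => C (c i)) X : Fin n → MvPolynomial (Fin (n-r)) R)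
      (pderiv (⟨r + j, hj⟩ : Fin n) Q) := by
  induction Q using MvPolynomial.induction_on with
  | C a => simp
  | add p q hp hq => simp only [map_add, hp, hq]
  | mul_X p l hp =>
    have key : pderiv j (glueCoords r n (fun i => C (c i)) X l : MvPolynomial (Fin (n-r)) R) =
        aeval (glueCoords r n (fun i => C (c i)) X : Fin n → MvPolynomial (Fin (n-r)) R)
          (pderiv (⟨r + j, hj⟩ : Fin n) (X l : MvPolynomial (Fin n) R)) := by
      unfold glueCoords
      split_ifs with h
      · rw [pderiv_X_of_ne (by rintro rfl; simp at h)]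
        simp
      · by_cases h2 : l = ⟨r + j, hj⟩
        · subst h2; simp
        · rw [pderiv_X_of_ne h2, pderiv_X_of_ne]
          · simp
          · intro h3
            apply h2
            ext
            have := congrArg Fin.val h3
            simp at this ⊢
            omega
    simp only [map_mul, aeval_X, Derivation.leibniz, hp, key, smul_eq_mul, map_add]

theorem glue_scale_aux {R : Type*} [CommRing R] {r n : ℕ} (e : R) (c : Fin r → R)
    (y : Fin (n - r) → R) :
    glueCoords r n (fun i => e * c i) (fun j => e * y j) =
      fun l => e * glueCoords r n c y l := by
  ext l
  unfold glueCoords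
  split_ifs <;> rfl

theorem glue_sum_aux {R : Type*} [CommRing R] {r n : ℕ} (hrn : r < n) (d : Fin n → R)
    (c : Fin r → R) (y : Fin (n - r) → R) :
    ∑ l, d l * glueCoords r n c y l =
      ∑ l : Fin r, d ⟨l, l.2.trans hrn⟩ * c l +
      ∑ j : Fin (n - r), d ⟨r + j, idx_aux j⟩ * y j := by
  rw [← (finSumFinEquiv.trans (finCongr (show r + (n - r) = n by omega))).sum_comp,
    Fintype.sum_sum_type]
  congr 1
  · refine Finset.sum_congr rfl fun l _ => ?_
    simp [glueCoords]
    rfl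
  · refine Finset.sum_congr rfl fun l _ => ?_
    simp [glueCoords]
    rfl

open MvPolynomial in
theorem eval_mem_aux {R σ : Type*} [CommRing R] (I : Ideal R) (x : σ → R) (hx : ∀ i, x i ∈ I)
    (Q : MvPolynomial σ R) (h : eval 0 Q = 0) : eval x Q ∈ I := by
  suffices eval x Q - eval 0 Q ∈ I by simpa only [h, sub_zero] using this
  clear h
  induction Q using MvPolynomial.induction_on with
  | C a => simp
  | add p q hp hq =>
    have := I.add_mem hp hq
    rw [map_add, map_add]
    convert this using 1
    ring
  | mul_X p l hp =>
    simp only [map_mul, eval_X, Pi.zero_apply, mul_zero, sub_zero]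
    exact I.mul_mem_left _ (hx l)

open MvPolynomial in
theorem glue_eval_aux {R : Type*} [CommRing R] {r n : ℕ} (c : Fin r → R) (y : Fin (n - r) → R)
    (Q : MvPolynomial (Fin n) R) :
    eval y (aeval (glueCoords r n (fun i => C (c i)) X : Fin n → MvPolynomial (Fin (n-r)) R) Q) =
    eval (glueCoords r n c y) Q := by
  induction Q using MvPolynomial.induction_on with
  | C a => simp
  | add p q hp hq => simp only [map_add, hp, hq]
  | mul_X p l hp =>
    simp only [map_mul, hp, aeval_X, eval_X]
    congr 1
    unfold glueCoords
    split_ifs <;> simp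

open MvPolynomial in
theorem core_aux {R : Type*} [CommRing R] [IsDomain R] [HenselianLocalRing R]
    {r n : ℕ} (hrn : r < n)
    (p : Fin (n - r) → MvPolynomial (Fin n) R)
    (hp0 : ∀ i, MvPolynomial.eval (0 : Fin n → R) (p i) = 0)
    (e : R)
    (he : e = Matrix.det fun i j : Fin (n - r) =>
      MvPolynomial.eval (0 : Fin n → R)
        (MvPolynomial.pderiv (⟨r + (j : ℕ), idx_aux j⟩ : Fin n) (p i)))
    (he0 : e ≠ 0) (u : Fin r → R) (hu : ∀ i, ∃ m ∈ IsLocalRing.maximalIdeal R, u i = e ^ 2 * m) :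
    ∃ v : Fin (n - r) → R, (∀ j, ∃ m ∈ IsLocalRing.maximalIdeal R, v j = e * m) ∧
      (∀ i, MvPolynomial.eval (glueCoords r n u v) (p i) = 0) := by
  choose Q hQ1 hQ2 hQ3 using fun i => scale_aux e (p i)
  choose m hm hum using hu
  let A : Matrix (Fin (n - r)) (Fin (n - r)) R := fun i j =>
      MvPolynomial.eval (0 : Fin n → R)
        (MvPolynomial.pderiv (⟨r + (j : ℕ), idx_aux j⟩ : Fin n) (p i))
  have hA : A.det = e := he.symm
  let b : Fin (n - r) → R := fun i => ∑ l : Fin r,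
    eval (0 : Fin n → R) (pderiv (⟨l, l.2.trans hrn⟩ : Fin n) (p i)) * m l
  let c : Fin r → R := fun l => e * m l
  have hu : u = fun l => e * c l := by
    ext l; rw [hum]; simp only [c]; ring
  have hev : ∀ (y : Fin (n - r) → R) i, eval (glueCoords r n u (fun j => e * y j)) (p i) =
      e ^ 2 * b i + e * A.mulVec y i + e ^ 2 * eval (glueCoords r n c y) (Q i) := by
    intro y i
    rw [hu, glue_scale_aux, hQ1, hp0, glue_sum_aux hrn]
    have : ∑ l : Fin r, eval (0 : Fin n → R) (pderiv (⟨l, l.2.trans hrn⟩ : Fin n) (p i)) * c l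
        = e * b i := by
      simp only [b, c, Finset.mul_sum]
      exact Finset.sum_congr rfl fun _ _ => by ring
    rw [this]
    simp only [Matrix.mulVec, dotProduct, A]
    ring
  let ψ : MvPolynomial (Fin n) R →ₐ[R] MvPolynomial (Fin (n - r)) R :=
    aeval (glueCoords r n (fun i => C (c i)) X)
  have hψ : ∀ y q, eval y (ψ q) = eval (glueCoords r n c y) q := glue_eval_aux c
  let G : Fin (n - r) → MvPolynomial (Fin (n - r)) R := fun i =>
    X i + ∑ l, C (A.adjugate i l) * (C (b l) + ψ (Q l))
  have hc : ∀ l, glueCoords r n c 0 l ∈ IsLocalRing.maximalIdeal R := by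
    intro l
    unfold glueCoords
    split_ifs
    · exact Ideal.mul_mem_left _ _ (hm _)
    · exact Ideal.zero_mem _
  have hb : ∀ i, b i ∈ IsLocalRing.maximalIdeal R := fun i =>
    Ideal.sum_mem _ fun l _ => Ideal.mul_mem_left _ _ (hm l)
  have hG0 : ∀ i, eval 0 (G i) ∈ IsLocalRing.maximalIdeal R := by
    intro i
    simp only [G, map_add, map_sum, map_mul, eval_X, eval_C, hψ, Pi.zero_apply, zero_add]
    exact Ideal.sum_mem _ fun l _ => Ideal.mul_mem_left _ _
      (Ideal.add_mem _ (hb l) (eval_mem_aux _ _ hc _ (hQ2 l)))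
  have hGd : ∀ i j, eval 0 (pderiv j (G i)) - (1 : Matrix _ _ R) i j
      ∈ IsLocalRing.maximalIdeal R := by
    intro i j
    have h1 : eval (0 : Fin (n - r) → R) (pderiv j (X i : MvPolynomial (Fin (n - r)) R))
        = (1 : Matrix _ _ R) i j := by
      rcases eq_or_ne i j with h | h
      · subst h; simp
      · rw [pderiv_X_of_ne h]; simp [h]
    have h2 : eval 0 (pderiv j (G i)) - (1 : Matrix _ _ R) i j =
        ∑ l, A.adjugate i l * eval (glueCoords r n c 0)
          (pderiv (⟨r + j, idx_aux j⟩ : Fin n) (Q l)) := by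
      simp only [G, map_add, map_sum, h1, pderiv_C_mul, pderiv_C, zero_add, map_mul, eval_C,
        add_sub_cancel_left]
      refine Finset.sum_congr rfl fun l _ => ?_
      rw [← hψ]
      simp only [ψ]
      rw [chain_aux c j (idx_aux j)]
    rw [h2]
    exact Ideal.sum_mem _ fun l _ => Ideal.mul_mem_left _ _ (eval_mem_aux _ _ hc _ (hQ3 l _))
  obtain ⟨y, hy, hGy⟩ := mvHensel_aux G hG0 (by
    apply isUnit_of_map_unit (IsLocalRing.residue R)
    have : (IsLocalRing.residue R).mapMatrix (Matrix.of fun i j : Fin (n - r) =>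
        eval (0 : Fin (n - r) → R) (pderiv j (G i))) = 1 := by
      rw [← map_one (IsLocalRing.residue R).mapMatrix]
      ext i j
      rw [RingHom.mapMatrix_apply, RingHom.mapMatrix_apply, Matrix.map_apply, Matrix.map_apply,
        ← sub_eq_zero, ← map_sub]
      exact (IsLocalRing.residue_eq_zero_iff _).mpr (hGd i j)
    have h3 := congrArg Matrix.det this
    rw [Matrix.det_one, ← RingHom.map_det] at h3
    change IsUnit (IsLocalRing.residue R (Matrix.det (Matrix.of fun i j : Fin (n - r) =>
        eval (0 : Fin (n - r) → R) (pderiv j (G i)))))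
    rw [h3]
    exact isUnit_one)
  refine ⟨fun j => e * y j, fun j => ⟨y j, hy j, rfl⟩, ?_⟩
  let w : Fin (n - r) → R := fun i => eval (glueCoords r n u (fun j => e * y j)) (p i)
  have hw : w = e ^ 2 • (fun i => b i + eval (glueCoords r n c y) (Q i)) + e • A.mulVec y := by
    ext i
    simp only [w, hev, Pi.add_apply, Pi.smul_apply, smul_eq_mul]
    ring
  have hadj : A.adjugate.mulVec w = 0 := by
    rw [hw, Matrix.mulVec_add, Matrix.mulVec_smul, Matrix.mulVec_smul, Matrix.mulVec_mulVec,
      Matrix.adjugate_mul, hA, Matrix.smul_mulVec, Matrix.one_mulVec]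
    ext i
    have := hGy i
    simp only [G, map_add, map_sum, map_mul, eval_X, eval_C, hψ] at this
    simp only [Pi.add_apply, Pi.smul_apply, smul_eq_mul, Matrix.mulVec, dotProduct, Pi.zero_apply]
    linear_combination e ^ 2 * this
  have hew : e • w = 0 := by
    have := congrArg A.mulVec hadj
    rwa [Matrix.mulVec_mulVec, Matrix.mul_adjugate, hA, Matrix.smul_mulVec, Matrix.one_mulVec,
      Matrix.mulVec_zero] at this
  intro i
  have := congrFun hew i
  exact (mul_eq_zero.mp this).resolve_left he0

theorem henselian_implicit_function
    {R : Type*} [CommRing R] [IsDomain R] [HenselianLocalRing R]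
    {r n : ℕ} (hrn : r < n)
    (p : Fin (n - r) → MvPolynomial (Fin n) R)
    (hp0 : ∀ i, MvPolynomial.eval (0 : Fin n → R) (p i) = 0)
    (e : R)
    (he : e = Matrix.det fun i j : Fin (n - r) =>
      MvPolynomial.eval (0 : Fin n → R)
        (MvPolynomial.pderiv (⟨r + (j : ℕ), by have := j.isLt; omega⟩ : Fin n) (p i)))
    (he0 : e ≠ 0) :
    ∃ φ : (Fin r → R) → (Fin (n - r) → R),
      φ 0 = 0 ∧
      (∀ u : Fin r → R, (∀ i, ∃ m ∈ IsLocalRing.maximalIdeal R, u i = e ^ 2 * m) →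
        (∀ j, ∃ m ∈ IsLocalRing.maximalIdeal R, φ u j = e * m) ∧
        (∀ i, MvPolynomial.eval (glueCoords r n u (φ u)) (p i) = 0)) ∧
      Set.InjOn (fun u => (u, φ u))
        {u : Fin r → R | ∀ i, ∃ m ∈ IsLocalRing.maximalIdeal R, u i = e ^ 2 * m} := by
  have key : ∀ u : Fin r → R, ∃ v : Fin (n - r) → R, (u = 0 → v = 0) ∧
      ((∀ i, ∃ m ∈ IsLocalRing.maximalIdeal R, u i = e ^ 2 * m) →
        (∀ j, ∃ m ∈ IsLocalRing.maximalIdeal R, v j = e * m) ∧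
        (∀ i, MvPolynomial.eval (glueCoords r n u v) (p i) = 0)) := by
    intro u
    by_cases h : u = 0
    · refine ⟨0, fun _ => rfl, fun _ => ⟨fun j => ⟨0, Ideal.zero_mem _, by simp⟩, fun i => ?_⟩⟩
      have : glueCoords r n u (0 : Fin (n - r) → R) = 0 := by
        subst h
        ext l
        unfold glueCoords
        split_ifs <;> rfl
      rw [this, hp0]
    · by_cases hu : ∀ i, ∃ m ∈ IsLocalRing.maximalIdeal R, u i = e ^ 2 * m
      · obtain ⟨v, hv⟩ := core_aux hrn p hp0 e he he0 u hu
        exact ⟨v, fun h' => absurd h' h, fun _ => hv⟩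
      · exact ⟨0, fun _ => rfl, fun h' => absurd h' hu⟩
  choose φ h1 h2 using key
  exact ⟨φ, h1 0 rfl, h2, fun u _ v _ h => congrArg Prod.fst h⟩
end

section
/- Let K be a Henselian valued field of equicharacteristic zero with valuation ring R and maximal ideal 𝔪, and let f = (f₁,…,fₙ) be an n-tuple of polynomials over R with f(0) ∈ 𝔪ⁿ and Jacobian determinant J(0) a unit in R. Then f is a homeomorphism of 𝔪ⁿ onto itself in the valuation topology. -/
open IsLocalRing in
theorem etale_lift {R B : Type*} [CommRing R] [HenselianLocalRing R] [CommRing B] [Algebra R B]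
    [Algebra.Etale R B] (φ : B →ₐ[R] ResidueField R) :
    ∃ ψ : B →ₐ[R] R, ∀ b, residue R (ψ b) = φ b := by
  let Q : Ideal B := RingHom.ker φ
  have hQ : Q.IsPrime := RingHom.ker_isPrime φ
  have : Algebra.FormallyEtale B (Localization.AtPrime Q) :=
    Algebra.FormallyEtale.of_isLocalization Q.primeCompl
  have : Algebra.IsEtaleAt R Q := Algebra.FormallyEtale.comp R B _
  obtain ⟨h, hh, ⟨⟨P⟩⟩⟩ := Algebra.IsEtaleAt.exists_isStandardEtale (R := R) Q
  have hu : IsUnit (φ h) := isUnit_iff_ne_zero.mpr hh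
  let φ' : Localization.Away h →ₐ[R] ResidueField R := IsLocalization.Away.liftAlgHom h hu
  have hφ' : ∀ b, φ' (algebraMap B _ b) = φ b := fun b => by
    simp [φ']
  have hm := P.hasMap.map φ'
  obtain ⟨b, hb⟩ := residue_surjective (φ' P.x)
  have hresb : ∀ p : Polynomial R, residue R (p.eval b) = Polynomial.aeval (φ' P.x) p := by
    intro p
    rw [← hb]
    exact (Polynomial.aeval_algebraMap_apply (ResidueField R) b p).symm
  obtain ⟨a, ha, hab⟩ := HenselianLocalRing.is_henselian P.f P.monic_f b
    (by rw [← residue_eq_zero_iff, hresb]; exact hm.1)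
    (by rw [← residue_ne_zero_iff_isUnit, hresb]; exact hm.isUnit_derivative_f.ne_zero)
  have ha0 : residue R a = φ' P.x := by
    rw [← hb, ← sub_eq_zero, ← map_sub, residue_eq_zero_iff]; exact hab
  have hres : ∀ p : Polynomial R, residue R (Polynomial.aeval a p) = Polynomial.aeval (φ' P.x) p := by
    intro p
    rw [← ha0]
    exact (Polynomial.aeval_algebraMap_apply (ResidueField R) a p).symm
  have hma : P.HasMap a := by
    refine ⟨by simpa [Polynomial.aeval_def] using ha, ?_⟩
    rw [← residue_ne_zero_iff_isUnit, hres]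
    exact hm.2.ne_zero
  let ψ' : Localization.Away h →ₐ[R] R := (P.P.lift a hma).comp P.equivRing.toAlgHom
  have key : (Algebra.ofId R (ResidueField R)).comp ψ' = φ' := by
    apply P.hom_ext
    simp [ψ', Algebra.ofId_apply, ha0]
  refine ⟨ψ'.comp (IsScalarTower.toAlgHom R B _), fun b => ?_⟩
  rw [← hφ', ← key]
  rfl

open IsLocalRing MvPolynomial in
theorem mv_hensel {R : Type*} [CommRing R] [HenselianLocalRing R] {n : ℕ}
    (f : Fin n → MvPolynomial (Fin n) R) (hf0 : ∀ i, eval 0 (f i) ∈ maximalIdeal R)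
    (hJ : IsUnit (Matrix.det (Matrix.of fun i j : Fin n => eval 0 (pderiv j (f i))))) :
    ∃ x : Fin n → R, (∀ i, x i ∈ maximalIdeal R) ∧ ∀ i, eval x (f i) = 0 := by
  classical
  let A := MvPolynomial (Fin n) R ⧸ (Ideal.span <| Set.range f)
  let P : Algebra.PreSubmersivePresentation R A (Fin n) (Fin n) :=
    { Algebra.Presentation.naive (v := f) with
      map := id
      map_inj := Function.injective_id }
  have hPval : ∀ i, P.val i = Ideal.Quotient.mk _ (X i) := fun i => rfl
  let B := Localization.Away P.jacobian
  let L := Algebra.SubmersivePresentation.localizationAway B P.jacobian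
  let S : Algebra.SubmersivePresentation R B (Unit ⊕ Fin n) (Unit ⊕ Fin n) :=
    { L.toPreSubmersivePresentation.comp P with
      jacobian_isUnit := by
        rw [Algebra.PreSubmersivePresentation.comp_jacobian_eq_jacobian_smul_jacobian,
          Algebra.smul_def, IsUnit.mul_iff]
        exact ⟨IsLocalization.Away.algebraMap_isUnit _, L.jacobian_isUnit⟩ }
  have : Algebra.IsStandardSmoothOfRelativeDimension 0 R B :=
    S.isStandardSmoothOfRelativeDimension (by simp [Algebra.Presentation.dimension])
  have : Algebra.Etale R B := inferInstance
  let e0 : MvPolynomial (Fin n) R →ₐ[R] ResidueField R := aeval 0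
  have he0 : ∀ p, e0 p = residue R (eval 0 p) := by
    intro p
    have := aeval_algebraMap_apply (ResidueField R) (0 : Fin n → R) p
    rw [show (algebraMap R (ResidueField R) ∘ (0 : Fin n → R)) = 0 by ext; simp] at this
    exact this
  let φA : A →ₐ[R] ResidueField R := Ideal.Quotient.liftₐ _ e0 (by
    intro a ha
    have : Ideal.span (Set.range f) ≤ RingHom.ker e0 := by
      rw [Ideal.span_le]
      rintro _ ⟨i, rfl⟩
      change e0 (f i) = 0
      rw [he0, residue_eq_zero_iff]
      exact hf0 i
    exact this ha)
  have hφA : ∀ p, φA (Ideal.Quotient.mk _ p) = e0 p := fun p => rfl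
  have hu : IsUnit (φA P.jacobian) := by
    have : P.jacobian = Ideal.Quotient.mk _ P.jacobiMatrix.det := by
      rw [P.jacobian_eq_jacobiMatrix_det, P.algebraMap_eq]
      change aeval P.val _ = _
      rw [show P.val = fun i => Ideal.Quotient.mkₐ R (Ideal.span (Set.range f)) (X i) from rfl]
      exact (DFunLike.congr_fun (aeval_unique
        (Ideal.Quotient.mkₐ R (Ideal.span (Set.range f)))) P.jacobiMatrix.det).symm
    rw [this, hφA, he0]
    apply IsUnit.map
    rw [RingHom.map_det, ← Matrix.det_transpose]
    convert hJ using 1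
    congr 1
    ext i j
    simp [Algebra.PreSubmersivePresentation.jacobiMatrix_apply]
    rfl
  let φ : B →ₐ[R] ResidueField R := IsLocalization.Away.liftAlgHom P.jacobian hu
  have hφ : ∀ a, φ (algebraMap A _ a) = φA a := fun b => by
    simp [φ]
  obtain ⟨ψ, hψ⟩ := etale_lift φ
  let g : MvPolynomial (Fin n) R →ₐ[R] R := 
    (ψ.comp (IsScalarTower.toAlgHom R A B)).comp (Ideal.Quotient.mkₐ R _)
  have hg : ∀ p, eval (fun i => g (X i)) p = g p := by
    intro p
    conv_rhs => rw [aeval_unique g]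
    rfl
  refine ⟨fun i => g (X i), fun i => ?_, fun i => ?_⟩
  · rw [← residue_eq_zero_iff]
    have := hψ (algebraMap A B (Ideal.Quotient.mk _ (X i)))
    rw [hφ, hφA] at this
    refine this.trans ?_
    simp [e0]
  · rw [hg]
    have : (Ideal.Quotient.mkₐ R (Ideal.span (Set.range f))) (f i) = 0 :=
      Ideal.Quotient.eq_zero_iff_mem.mpr (Ideal.subset_span ⟨i, rfl⟩)
    simp only [g, AlgHom.comp_apply, this, map_zero]

open IsLocalRing MvPolynomial in
theorem diff_formula {R : Type*} [CommRing R] [IsLocalRing R] {n : ℕ} (x y : Fin n → R)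
    (hx : ∀ i, x i ∈ maximalIdeal R) (hy : ∀ i, y i ∈ maximalIdeal R)
    (p : MvPolynomial (Fin n) R) :
    (eval x p - eval 0 p ∈ maximalIdeal R ∧ eval y p - eval 0 p ∈ maximalIdeal R) ∧
    ∃ c : Fin n → R, (∀ j, c j ∈ maximalIdeal R) ∧
      eval x p - eval y p = ∑ j, (eval 0 (pderiv j p) + c j) * (x j - y j) := by
  classical
  induction p using MvPolynomial.induction_on with
  | C a => exact ⟨by simp, 0, by simp, by simp⟩
  | add p q hp hq =>
    obtain ⟨⟨h1, h2⟩, c, hc, e⟩ := hp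
    obtain ⟨⟨h3, h4⟩, d, hd, e'⟩ := hq
    refine ⟨⟨?_, ?_⟩, c + d, fun j => add_mem (hc j) (hd j), ?_⟩
    · convert add_mem h1 h3 using 1; simp; ring
    · convert add_mem h2 h4 using 1; simp; ring
    · rw [map_add, map_add, add_sub_add_comm, e, e', ← Finset.sum_add_distrib]
      refine Finset.sum_congr rfl fun j _ => ?_
      simp; ring
  | mul_X p i hp =>
    obtain ⟨⟨h1, h2⟩, c, hc, e⟩ := hp
    refine ⟨⟨?_, ?_⟩, fun j => (eval 0 (pderiv j p) + c j) * x i +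
      (if j = i then eval y p - eval 0 p else 0), fun j => ?_, ?_⟩
    · simpa using Ideal.mul_mem_left _ _ (hx i)
    · simpa using Ideal.mul_mem_left _ _ (hy i)
    · refine add_mem (Ideal.mul_mem_left _ _ (hx i)) ?_
      split_ifs
      exacts [h2, zero_mem _]
    · have : eval x (p * X i) - eval y (p * X i) =
        (eval x p - eval y p) * x i + eval y p * (x i - y i) := by simp; ring
      rw [this, e, Finset.sum_mul]
      have h : eval y p * (x i - y i) = ∑ j, if j = i then eval y p * (x j - y j) else 0 := by simp
      rw [h, ← Finset.sum_add_distrib]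
      refine Finset.sum_congr rfl fun j _ => ?_
      by_cases hj : j = i
      · subst hj; simp [pderiv_X]; ring
      · simp [hj, pderiv_X, Ne.symm hj]; ring

open IsLocalRing MvPolynomial in
/-- differences of arguments are combinations of differences of values -/
theorem inv_formula {R : Type*} [CommRing R] [IsLocalRing R] {n : ℕ}
    (f : Fin n → MvPolynomial (Fin n) R)
    (hJ : IsUnit (Matrix.det (Matrix.of fun i j : Fin n => eval 0 (pderiv j (f i)))))
    (x y : Fin n → R)
    (hx : ∀ i, x i ∈ maximalIdeal R) (hy : ∀ i, y i ∈ maximalIdeal R) :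
    ∃ N : Matrix (Fin n) (Fin n) R, ∀ i,
      x i - y i = ∑ j, N i j * (eval x (f j) - eval y (f j)) := by
  choose c hc e using fun i => (diff_formula x y hx hy (f i)).2
  let M : Matrix (Fin n) (Fin n) R := fun i j => eval 0 (pderiv j (f i)) + c i j
  have hM : IsUnit M.det := by
    rw [← residue_ne_zero_iff_isUnit] at hJ ⊢
    rw [RingHom.map_det] at hJ ⊢
    convert hJ using 2
    ext i j
    have := (residue_eq_zero_iff (c i j)).mpr (hc i j)
    change residue R (eval 0 (pderiv j (f i)) + c i j) = residue R (eval 0 (pderiv j (f i)))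
    rw [map_add, this, add_zero]
  refine ⟨M⁻¹, fun i => ?_⟩
  have h1 : (fun j => eval x (f j) - eval y (f j)) = M.mulVec (x - y) := by
    ext j
    rw [e]; rfl
  have h2 : M⁻¹.mulVec (fun j => eval x (f j) - eval y (f j)) = x - y := by
    rw [h1, Matrix.mulVec_mulVec, Matrix.nonsing_inv_mul _ hM, Matrix.one_mulVec]
  exact (congrFun h2 i).symm


/-- Over a Henselian valued field `K` of equicharacteristic zero with valuation ring `R`
and maximal ideal `𝔪`, an `n`-tuple `f` of polynomials with coefficients in `R`,
`f(0) ∈ 𝔪ⁿ` and Jacobian determinant at `0` a unit of `R` is a homeomorphism of `𝔪ⁿ`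
onto itself in the valuation topology. -/
theorem henselian_valued_polynomial_tuple_homeomorph
    {K : Type*} [Field K] {Γ₀ : Type*} [LinearOrderedCommGroupWithZero Γ₀]
    [Valued K Γ₀]
    [HenselianLocalRing ↥((Valued.v : Valuation K Γ₀).valuationSubring)]
    [CharZero K]
    [CharZero (IsLocalRing.ResidueField ↥((Valued.v : Valuation K Γ₀).valuationSubring))]
    {n : ℕ} (f : Fin n → MvPolynomial (Fin n) K)
    (hcoeff : ∀ i d, Valued.v (MvPolynomial.coeff d (f i)) ≤ (1 : Γ₀))
    (hf0 : ∀ i, Valued.v (MvPolynomial.eval (0 : Fin n → K) (f i)) < (1 : Γ₀))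
    (hJ : Valued.v (Matrix.det fun i j : Fin n =>
      MvPolynomial.eval (0 : Fin n → K) (MvPolynomial.pderiv j (f i))) = (1 : Γ₀)) :
    ∃ F : {x : Fin n → K // ∀ i, Valued.v (x i) < (1 : Γ₀)} ≃ₜ
          {x : Fin n → K // ∀ i, Valued.v (x i) < (1 : Γ₀)},
      ∀ x (i : Fin n), (F x : Fin n → K) i = MvPolynomial.eval (x : Fin n → K) (f i) := by
  classical
  let v : Valuation K Γ₀ := Valued.v
  let R := v.valuationSubring
  have hmax : ∀ a : R, a ∈ IsLocalRing.maximalIdeal R ↔ v a < 1 := fun a =>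
    v.mem_maximalIdeal_iff
  have hlift : ∀ i, ∃ p : MvPolynomial (Fin n) R, MvPolynomial.map (algebraMap R K) p = f i := by
    intro i
    have : f i ∈ Set.range (MvPolynomial.map (algebraMap R K) :
        MvPolynomial (Fin n) R →+* MvPolynomial (Fin n) K) := by
      rw [MvPolynomial.mem_range_map_iff_coeffs_subset]
      intro a ha
      obtain ⟨d, -, rfl⟩ := MvPolynomial.mem_coeffs_iff.mp ha
      exact ⟨⟨_, hcoeff i d⟩, rfl⟩
    exact this
  choose p hp using hlift
  have hev : ∀ (x : Fin n → R) (q : MvPolynomial (Fin n) R),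
      MvPolynomial.eval (fun i => (x i : K)) (MvPolynomial.map (algebraMap R K) q) =
        ((MvPolynomial.eval x q : R) : K) := by
    intro x q
    rw [MvPolynomial.eval_map]
    exact (MvPolynomial.eval₂_comp_left (algebraMap R K) (RingHom.id R) x q).symm
  have hev0 : ∀ (q : MvPolynomial (Fin n) R),
      MvPolynomial.eval (0 : Fin n → K) (MvPolynomial.map (algebraMap R K) q) =
        ((MvPolynomial.eval 0 q : R) : K) := fun q => hev 0 q
  have hp0 : ∀ i, MvPolynomial.eval 0 (p i) ∈ IsLocalRing.maximalIdeal R := by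
    intro i
    rw [hmax, ← hev0, hp]
    exact hf0 i
  have hJ' : IsUnit (Matrix.det (Matrix.of fun i j : Fin n =>
      MvPolynomial.eval 0 (MvPolynomial.pderiv j (p i)))) := by
    by_contra hcon
    have h1 := (hmax _).mp ((IsLocalRing.mem_maximalIdeal _).mpr hcon)
    refine h1.ne ?_
    rw [← hJ]
    congr 1
    refine ((algebraMap R K).map_det _).trans ?_
    congr 1
    ext i j
    change algebraMap R K (MvPolynomial.eval 0 (MvPolynomial.pderiv j (p i))) = _
    rw [← hp, MvPolynomial.pderiv_map, hev0]
    rfl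
  let D := {x : Fin n → K // ∀ i, Valued.v (x i) < (1 : Γ₀)}
  let lft : D → Fin n → R := fun x i => ⟨x.1 i, (x.2 i).le⟩
  have hlft : ∀ x i, lft x i ∈ IsLocalRing.maximalIdeal R := fun x i => (hmax _).mpr (x.2 i)
  have hevf : ∀ (x : D) i, MvPolynomial.eval x.1 (f i) =
      ((MvPolynomial.eval (lft x) (p i) : R) : K) := by
    intro x i
    rw [← hp]
    exact hev (lft x) (p i)
  let T : D → D := fun x => ⟨fun i => MvPolynomial.eval x.1 (f i), fun i => by
    beta_reduce
    rw [hevf]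
    refine (hmax _).mp ?_
    have h1 := (diff_formula (lft x) (lft x) (hlft x) (hlft x) (p i)).1.1
    simpa using add_mem h1 (hp0 i)⟩
  have hkey : ∀ x y : D, ∃ N : Matrix (Fin n) (Fin n) R, ∀ i,
      x.1 i - y.1 i = ∑ j, (N i j : K) * ((T x).1 j - (T y).1 j) := by
    intro x y
    obtain ⟨N, hN⟩ := inv_formula p hJ' (lft x) (lft y) (hlft x) (hlft y)
    refine ⟨N, fun i => ?_⟩
    have := congrArg (algebraMap R K) (hN i)
    rw [map_sum] at this
    simp only [map_mul, map_sub] at this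
    refine this.trans (Finset.sum_congr rfl fun j _ => ?_)
    simp only [T, hevf]
    rfl
  have hinj : Function.Injective T := by
    intro x y hxy
    obtain ⟨N, hN⟩ := hkey x y
    apply Subtype.ext
    funext i
    rw [← sub_eq_zero, hN, hxy]
    simp
  have hsurj : Function.Surjective T := by
    intro y
    obtain ⟨x, hx, hxe⟩ := mv_hensel (fun i => p i - MvPolynomial.C (lft y i))
      (fun i => by
        rw [map_sub, MvPolynomial.eval_C]
        exact sub_mem (hp0 i) (hlft y i))
      (by simpa using hJ')
    refine ⟨⟨fun i => x i, fun i => (hmax _).mp (hx i)⟩, ?_⟩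
    apply Subtype.ext
    funext i
    have h2 := hxe i
    rw [map_sub, MvPolynomial.eval_C, sub_eq_zero] at h2
    change MvPolynomial.eval (fun i => (x i : K)) (f i) = _
    rw [← hp, hev, h2]
  let E : D ≃ D := Equiv.ofBijective T ⟨hinj, hsurj⟩
  have hE : ∀ x, E x = T x := fun x => rfl
  have hcont : Continuous T := by
    refine Continuous.subtype_mk (continuous_pi fun i => ?_) _
    exact (MvPolynomial.continuous_eval (f i)).comp continuous_subtype_val
  have hcontinv : Continuous E.symm := by
    refine continuous_induced_rng.mpr (continuous_pi fun i => ?_)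
    rw [continuous_iff_continuousAt]
    intro y
    intro s hs
    obtain ⟨γ, hγ⟩ := Valued.mem_nhds.mp hs
    rw [Filter.mem_map]
    have hev : ∀ j, ∀ᶠ z : D in nhds y,
        (Valued.v : Valuation K Γ₀).restrict (z.1 j - y.1 j) < γ.1 := by
      intro j
      have hc : ContinuousAt (fun z : D => z.1 j) y :=
        ((continuous_apply j).comp continuous_subtype_val).continuousAt
      exact hc (Valued.mem_nhds.mpr ⟨γ, subset_rfl⟩)
    filter_upwards [Filter.eventually_all.mpr hev] with z hz
    apply hγ
    change (Valued.v : Valuation K Γ₀).restrict ((E.symm z).1 i - (E.symm y).1 i) < γ.1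
    obtain ⟨N, hN⟩ := hkey (E.symm z) (E.symm y)
    rw [hN]
    refine Valuation.map_sum_lt _ γ.ne_zero fun j _ => ?_
    rw [← hE, ← hE, Equiv.apply_symm_apply, Equiv.apply_symm_apply, map_mul]
    refine lt_of_le_of_lt (mul_le_of_le_one_left' ?_) (hz j)
    exact (Valuation.restrict_le_one_iff _).mpr (N i j).2
  exact ⟨⟨E, hcont, hcontinv⟩, fun x i => rfl⟩
end

section
/- Let K be a Henselian valued field of equicharacteristic zero with a nontrivial valuation. Then K satisfies the density property: if C is a smooth, irreducible curve over K, then the set C(K) of K-rational points has no isolated points in the valuation topology. -/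
open Polynomial Topology Filter

lemma hensel_aux {K : Type*} [Field K] {Γ₀ : Type*} [LinearOrderedCommGroupWithZero Γ₀]
    (v : Valuation K Γ₀) [HenselianLocalRing v.valuationSubring]
    (p : K[X]) (N : ℕ) (hN : p.natDegree < N) (hN2 : 2 ≤ N) (h1 : p.coeff 1 ≠ 0)
    (h : ∀ j ∈ Finset.Ico 2 N, v (p.coeff j * p.coeff 0 ^ (j - 1) / p.coeff 1 ^ j) < 1) :
    ∃ y, p.eval y = 0 ∧ v y = v (p.coeff 0 / p.coeff 1) := by
  have h1' : ∀ j : ℕ, ∃ c : v.valuationSubring, c ∈ IsLocalRing.maximalIdeal v.valuationSubring ∧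
      (j ∈ Finset.Ico 2 N → (c : K) = (-1) ^ j * (p.coeff j * p.coeff 0 ^ (j - 1) / p.coeff 1 ^ j)) := by
    intro j
    by_cases hj : j ∈ Finset.Ico 2 N
    · have hlt : v ((-1) ^ j * (p.coeff j * p.coeff 0 ^ (j - 1) / p.coeff 1 ^ j)) < 1 := by
        rw [map_mul, map_pow, Valuation.map_neg, map_one, one_pow, one_mul]
        exact h j hj
      refine ⟨⟨_, hlt.le⟩, ?_, fun _ => rfl⟩
      rw [IsLocalRing.mem_maximalIdeal, mem_nonunits_iff]
      intro hu
      have := (Valuation.Integers.isUnit_iff_valuation_eq_one (Valuation.integer.integers v) (x := ⟨_, hlt.le⟩)).1 hu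
      exact hlt.ne this
    · exact ⟨0, zero_mem _, fun h => absurd h hj⟩
  choose c hc hcv using h1'
  set r : (v.valuationSubring)[X] := ∑ j ∈ Finset.Ico 2 N, C (c j) * X ^ (N - j) with hr
  have hrdeg : r.degree < ((N - 1 : ℕ) : WithBot ℕ) := by
    refine lt_of_le_of_lt (degree_sum_le _ _) ?_
    rw [Finset.sup_lt_iff (WithBot.bot_lt_coe _)]
    intro j hj
    refine lt_of_le_of_lt (degree_C_mul_X_pow_le _ _) ?_
    rw [Finset.mem_Ico] at hj
    exact_mod_cast (by omega : N - j < N - 1)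
  obtain ⟨M, rfl⟩ : ∃ M, N = M + 1 := ⟨N - 1, by omega⟩
  simp only [Nat.add_sub_cancel] at hrdeg
  have hmon : (X ^ (M + 1) + (r - X ^ M)).Monic := by
    apply monic_X_pow_add
    refine lt_of_le_of_lt (degree_sub_le _ _) (max_lt (hrdeg.trans ?_) ?_)
    · exact_mod_cast Nat.lt_succ_self M
    · rw [degree_X_pow]; exact_mod_cast Nat.lt_succ_self M
  have hev : eval 1 r ∈ IsLocalRing.maximalIdeal v.valuationSubring := by
    rw [hr, eval_finsetSum]
    exact Ideal.sum_mem _ fun j _ => by simpa using hc j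
  have hdev : eval 1 (derivative r) ∈ IsLocalRing.maximalIdeal v.valuationSubring := by
    rw [hr, derivative_sum, eval_finsetSum]
    refine Ideal.sum_mem _ fun j _ => ?_
    rw [derivative_C_mul, eval_mul, eval_C]
    exact Ideal.mul_mem_right _ _ (hc j)
  have unit_of : ∀ u : v.valuationSubring, u - 1 ∈ IsLocalRing.maximalIdeal v.valuationSubring → IsUnit u := by
    intro u hu
    by_contra hn
    have h3 : u ∈ IsLocalRing.maximalIdeal v.valuationSubring := hn
    have := Ideal.sub_mem _ h3 hu
    rw [sub_sub_cancel] at this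
    exact (Ideal.ne_top_iff_one _).1 (IsLocalRing.maximalIdeal.isMaximal _).ne_top this
  obtain ⟨V, hV, hV1⟩ := HenselianLocalRing.is_henselian _ hmon 1 (by simpa using hev) (by
    apply unit_of
    convert hdev using 1
    simp [derivative_X_pow]
    ring)
  have hVu := unit_of V hV1
  have hvV : v (V : K) = 1 :=
    (Valuation.Integers.isUnit_iff_valuation_eq_one (Valuation.integer.integers v) (x := V)).1 hVu
  have hV0 : (V : K) ≠ 0 := by
    intro h0; rw [h0, map_zero] at hvV; exact zero_ne_one hvV
  refine ⟨-(p.coeff 0 / p.coeff 1) / V, ?_, by rw [map_div₀, Valuation.map_neg, hvV, div_one]⟩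
  have hroot : (V : K) ^ (M + 1) + (∑ j ∈ Finset.Ico 2 (M + 1), (c j : K) * V ^ (M + 1 - j) - V ^ M) = 0 := by
    have := congrArg (Subtype.val) hV
    simpa [hr, eval_finsetSum] using this
  rw [eval_eq_sum_range' hN, Finset.range_eq_Ico, Finset.sum_eq_sum_Ico_succ_bot (by omega), Finset.sum_eq_sum_Ico_succ_bot (by omega)]
  have hsum : (V : K) ^ (M + 1) * ∑ j ∈ Finset.Ico 2 (M + 1), p.coeff j * (-(p.coeff 0 / p.coeff 1) / (V : K)) ^ j
      = p.coeff 0 * ∑ j ∈ Finset.Ico 2 (M + 1), (c j : K) * V ^ (M + 1 - j) := by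
    rw [Finset.mul_sum, Finset.mul_sum]
    refine Finset.sum_congr rfl fun j hj => ?_
    rw [hcv j hj]
    rw [Finset.mem_Ico] at hj
    obtain ⟨i, rfl⟩ : ∃ i, j = i + 1 := ⟨j - 1, by omega⟩
    obtain ⟨k, hk⟩ : ∃ k, M + 1 = i + 1 + k := ⟨M - i, by omega⟩
    rw [hk, Nat.add_sub_cancel_left, Nat.add_sub_cancel, neg_div, neg_pow, div_pow, div_pow]
    field_simp
    ring
  have hp : (V : K) ^ (M + 1) ≠ 0 := pow_ne_zero _ hV0
  refine mul_left_cancel₀ hp ?_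
  simp only [zero_add, Nat.reduceAdd, mul_add, hsum, mul_zero]
  have : ∑ j ∈ Finset.Ico 2 (M + 1), (c j : K) * V ^ (M + 1 - j) = V ^ M - V ^ (M + 1) := by
    linear_combination hroot
  rw [this]
  field_simp
  ring

lemma continuous_eval₂ {K : Type*} [Field K] [TopologicalSpace K] [IsTopologicalRing K] {d : ℕ}
    (F : (MvPolynomial (Fin d) K)[X]) :
    Continuous fun z : (Fin d → K) × K => (F.map (MvPolynomial.eval z.1)).eval z.2 := by
  induction F using Polynomial.induction_on' with
  | add p q hp hq =>
    simp only [Polynomial.map_add, eval_add]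
    exact hp.add hq
  | monomial n a =>
    simp only [map_monomial, eval_monomial]
    have := MvPolynomial.continuous_eval a
    fun_prop

lemma implicit_aux {K : Type*} [Field K] {Γ₀ : Type*} [LinearOrderedCommGroupWithZero Γ₀]
    [Valued K Γ₀]
    [HenselianLocalRing ↥((Valued.v : Valuation K Γ₀).valuationSubring)] {d : ℕ}
    (F : (MvPolynomial (Fin d) K)[X]) (t₀ : Fin d → K) (a₀ : K)
    (h0 : (F.map (MvPolynomial.eval t₀)).eval a₀ = 0)
    (h1 : (F.derivative.map (MvPolynomial.eval t₀)).eval a₀ ≠ 0)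
    (W : Set K) (hW : W ∈ 𝓝 a₀) :
    ∀ᶠ t in 𝓝 t₀, ∃ a ∈ W, (F.map (MvPolynomial.eval t)).eval a = 0 := by
  set G := taylor (MvPolynomial.C a₀) F with hG
  have hGt : ∀ t, G.map (MvPolynomial.eval t) = taylor a₀ (F.map (MvPolynomial.eval t)) := by
    intro t; simp [hG, map_taylor]
  set b : ℕ → (Fin d → K) → K := fun j t => MvPolynomial.eval t (G.coeff j) with hb
  have hbG : ∀ j t, (taylor a₀ (F.map (MvPolynomial.eval t))).coeff j = b j t := by
    intro j t; rw [← hGt, coeff_map]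
  have hbc : ∀ j, Continuous (b j) := fun j => MvPolynomial.continuous_eval _
  have hb0 : b 0 t₀ = 0 := by rw [← hbG, taylor_coeff_zero, h0]
  have hb1 : b 1 t₀ ≠ 0 := by rw [← hbG, taylor_coeff_one, derivative_map]; exact h1
  have hsm : ∀ j ∈ Finset.Ico 2 (G.natDegree + 2),
      ∀ᶠ t in 𝓝 t₀, (Valued.v (b j t * b 0 t ^ (j - 1) / b 1 t ^ j) : Γ₀) < 1 := by
    intro j hj
    rw [Finset.mem_Ico] at hj
    have hcont : ContinuousAt (fun t => b j t * b 0 t ^ (j - 1) / b 1 t ^ j) t₀ :=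
      ContinuousAt.div (((hbc j).mul ((hbc 0).pow _)).continuousAt) ((hbc 1).pow _).continuousAt
        (pow_ne_zero _ hb1)
    have hz : b j t₀ * b 0 t₀ ^ (j - 1) / b 1 t₀ ^ j = 0 := by
      rw [hb0, zero_pow (by omega)]; simp
    have : {x : K | (Valued.v x : Γ₀) < 1} ∈ 𝓝 (0 : K) := by
      rw [Valued.mem_nhds_zero]
      exact ⟨1, fun x hx => by simpa using hx⟩
    unfold ContinuousAt at hcont
    beta_reduce at hcont
    rw [hz] at hcont
    exact hcont this
  have hall := (Finset.eventually_all _).2 hsm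
  have hb1' : ∀ᶠ t in 𝓝 t₀, b 1 t ≠ 0 := (hbc 1).continuousAt.eventually_ne hb1
  have hW' : ∃ γ : (MonoidWithZeroHom.ValueGroup₀ (.ofClass (Valued.v : Valuation K Γ₀)))ˣ,
    { y | (Valued.v.restrict (y - a₀) ) < γ.1 } ⊆ W := Valued.mem_nhds.1 hW
  obtain ⟨γ, hγ⟩ := hW'
  have hq : ∀ᶠ t in 𝓝 t₀, Valued.v.restrict (b 0 t / b 1 t) < γ.1 := by
    have hcont : ContinuousAt (fun t => b 0 t / b 1 t) t₀ :=
      ContinuousAt.div (hbc 0).continuousAt (hbc 1).continuousAt hb1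
    unfold ContinuousAt at hcont
    beta_reduce at hcont
    rw [hb0, zero_div] at hcont
    exact hcont (Valued.mem_nhds_zero.2 ⟨γ, subset_rfl⟩)
  filter_upwards [hall, hb1', hq] with t ht1 ht2 ht3
  obtain ⟨y, hy, hvy⟩ := hensel_aux (Valued.v : Valuation K Γ₀) (taylor a₀ (F.map (MvPolynomial.eval t))) (G.natDegree + 2)
    (by rw [← hGt]; exact lt_of_le_of_lt natDegree_map_le (by omega)) (by omega) (by rwa [hbG])
    (by intro j hj; simp only [hbG]; exact ht1 j hj)
  refine ⟨y + a₀, hγ ?_, by rwa [taylor_eval] at hy⟩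
  simp only [hbG] at hvy
  show Valued.v.restrict (y + a₀ - a₀) < γ.1
  rw [add_sub_cancel_right]
  rw [Valuation.restrict_lt_iff_lt_embedding] at ht3 ⊢
  rwa [hvy]

lemma exists_hom {K : Type*} [Field K] {d : ℕ} {S : Type*} [CommRing S]
    [Algebra (MvPolynomial (Fin d) K) S] (P : StandardEtalePresentation (MvPolynomial (Fin d) K) S)
    (t : Fin d → K) (a : K) (h0 : (P.f.map (MvPolynomial.eval t)).eval a = 0)
    (h1 : (P.g.map (MvPolynomial.eval t)).eval a ≠ 0) :
    ∃ φ : S →+* K, φ.comp (algebraMap _ S) = MvPolynomial.eval t ∧ φ P.x = a := by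
  let _ : Algebra (MvPolynomial (Fin d) K) K := (MvPolynomial.eval t).toAlgebra
  have hm : P.HasMap a := by
    refine ⟨?_, ?_⟩
    · rw [← h0, eval_map]; rfl
    · rw [isUnit_iff_ne_zero]; rw [eval_map] at h1; exact h1
  let ψ := (P.P.lift a hm).comp P.equivRing.toAlgHom
  refine ⟨ψ.toRingHom, ?_, ?_⟩
  · exact ψ.comp_algebraMap
  · simp [ψ]

lemma hom_formula {K : Type*} [Field K] {d : ℕ} {S : Type*} [CommRing S]
    [Algebra (MvPolynomial (Fin d) K) S] (x : S)
    (t : Fin d → K) (φ : S →+* K) (hφ : φ.comp (algebraMap _ S) = MvPolynomial.eval t)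
    (p : (MvPolynomial (Fin d) K)[X]) : φ (aeval x p) = (p.map (MvPolynomial.eval t)).eval (φ x) := by
  rw [eval_map, ← hφ, aeval_def, hom_eval₂]

lemma nhdsNE {K : Type*} [Field K] {Γ₀ : Type*} [LinearOrderedCommGroupWithZero Γ₀]
    [Valued K Γ₀] (hnontriv : ∃ x : K, Valued.v x ≠ (0 : Γ₀) ∧ Valued.v x ≠ (1 : Γ₀)) :
    (𝓝[≠] (0 : K)).NeBot := by
  obtain ⟨z, hz0, hz1⟩ := hnontriv
  obtain ⟨z, hz0, hz1⟩ : ∃ z : K, z ≠ 0 ∧ (Valued.v z : Γ₀) < 1 := by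
    have : z ≠ 0 := by rintro rfl; simp at hz0
    rcases lt_or_gt_of_ne hz1 with h | h
    · exact ⟨z, this, h⟩
    · exact ⟨z⁻¹, inv_ne_zero this, by rw [map_inv₀]; exact inv_lt_one_of_one_lt₀ h⟩
  rw [← mem_closure_iff_nhdsWithin_neBot, mem_closure_iff_nhds]
  intro s hs
  obtain ⟨γ, hγ⟩ := Valued.mem_nhds_zero.1 hs
  obtain ⟨w, hw⟩ := MonoidWithZeroHom.ValueGroup₀.restrict₀_surjective _ γ.1
  have hw' : Valued.v.restrict w = γ.1 := hw
  have hw0 : w ≠ 0 := by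
    rintro rfl
    rw [map_zero] at hw'
    exact γ.ne_zero hw'.symm
  refine ⟨z * w, hγ ?_, mul_ne_zero hz0 hw0⟩
  show Valued.v.restrict (z * w) < γ.1
  rw [← hw', Valuation.restrict_lt_iff, map_mul]
  have : (0 : Γ₀) < Valued.v w := by rw [Valuation.pos_iff]; exact hw0
  exact mul_lt_of_lt_one_left this hz1

lemma dim_zero_absurd {K A S : Type*} [Field K] [CommRing A] [IsDomain A] [Algebra K A]
    [CommRing S] [Algebra A S] [Algebra K S] [IsScalarTower K A S] (g : A) (hg : g ≠ 0)
    [IsLocalization.Away g S]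
    [Algebra (MvPolynomial (Fin 0) K) S] [IsScalarTower K (MvPolynomial (Fin 0) K) S]
    [Algebra.Etale (MvPolynomial (Fin 0) K) S]
    (hdim : ringKrullDim A = 1) (φ : S →+* K) (ψ : A →ₐ[K] K) (h : φ.comp (algebraMap A S) = ψ) :
    False := by
  have hle : Submonoid.powers g ≤ nonZeroDivisors A := powers_le_nonZeroDivisors_of_noZeroDivisors hg
  have : IsDomain S := IsLocalization.isDomain_of_le_nonZeroDivisors S hle
  have : Algebra.Etale K (MvPolynomial (Fin 0) K) :=
    .of_equiv (MvPolynomial.isEmptyAlgEquiv K (Fin 0)).symm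
  have : Algebra.Etale K S := .comp K (MvPolynomial (Fin 0) K) S
  have : Module.Finite K S := Algebra.FormallyUnramified.finite_of_free K S
  have hf : IsField S := isField_of_isIntegral_of_isField' (Field.toIsField K)
  have hφ : Function.Injective φ := by
    letI := hf.toField
    exact φ.injective
  have hinj : Function.Injective ψ := by
    have : Function.Injective (φ.comp (algebraMap A S)) :=
      hφ.comp (IsLocalization.injective S hle)
    rw [h] at this
    exact this
  have hbij : Function.Bijective ψ := ⟨hinj, fun k => ⟨algebraMap K A k, by simp⟩⟩
  have := ringKrullDim_eq_of_ringEquiv (RingEquiv.ofBijective ψ hbij)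
  rw [hdim, ringKrullDim_eq_zero_of_field] at this
  exact one_ne_zero this

/-- Density property of Henselian non-trivially valued fields of equicharacteristic zero:
the set of `K`-rational points of a smooth irreducible curve `C` over `K` has no isolated
points in the valuation topology. -/
theorem henselian_valued_field_density_property
    {K : Type*} [Field K] {Γ₀ : Type*} [LinearOrderedCommGroupWithZero Γ₀]
    [Valued K Γ₀]
    [HenselianLocalRing ↥((Valued.v : Valuation K Γ₀).valuationSubring)]
    [CharZero K]
    [CharZero (IsLocalRing.ResidueField ↥((Valued.v : Valuation K Γ₀).valuationSubring))]
    (hnontriv : ∃ x : K, Valued.v x ≠ (0 : Γ₀) ∧ Valued.v x ≠ (1 : Γ₀))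
    {n : ℕ} (I : Ideal (MvPolynomial (Fin n) K)) [I.IsPrime]
    (hsmooth : Algebra.Smooth K (MvPolynomial (Fin n) K ⧸ I))
    (hdim : ringKrullDim (MvPolynomial (Fin n) K ⧸ I) = 1)
    (x : Fin n → K) (hx : ∀ p ∈ I, MvPolynomial.eval x p = 0) :
    ∀ U : Set (Fin n → K), IsOpen U → x ∈ U →
      ∃ y : Fin n → K, y ∈ U ∧ (∀ p ∈ I, MvPolynomial.eval y p = 0) ∧ y ≠ x := by
  intro U hU hxU
  let ψ : (MvPolynomial (Fin n) K ⧸ I) →ₐ[K] K := Ideal.Quotient.liftₐ I (MvPolynomial.aeval x)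
    (fun p hp => by rw [MvPolynomial.aeval_eq_eval]; exact hx p hp)
  have hψX : ∀ i, ψ (Ideal.Quotient.mk I (MvPolynomial.X i)) = x i := by
    intro i
    exact (Ideal.Quotient.liftₐ_apply I _ _ _).trans (by simp)
  have hprime : (RingHom.ker ψ).IsPrime := RingHom.ker_isPrime _
  have : Algebra.IsSmoothAt K (RingHom.ker ψ) := inferInstance
  obtain ⟨g, hg, d, inst1, inst2, inst3⟩ :=
    Algebra.IsSmoothAt.exists_isStandardEtale_mvPolynomial (R := K) (p := RingHom.ker ψ)
  obtain ⟨P⟩ := inst3.nonempty_standardEtalePresentation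
  have hgψ : ψ g ≠ 0 := fun h => hg h
  have hgu : IsUnit (ψ.toRingHom g) := isUnit_iff_ne_zero.2 hgψ
  have hg0 : g ≠ 0 := by rintro rfl; simp at hgψ
  let φ₀ : Localization.Away g →+* K := IsLocalization.Away.lift g hgu
  have hφ₀ : φ₀.comp (algebraMap (MvPolynomial (Fin n) K ⧸ I) (Localization.Away g)) = (ψ : (MvPolynomial (Fin n) K ⧸ I) →+* K) :=
    IsLocalization.Away.lift_comp (S := Localization.Away g) g hgu
  have hφ₀C : ∀ k, φ₀ (algebraMap K _ k) = k := by
    intro k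
    rw [IsScalarTower.algebraMap_apply K (MvPolynomial (Fin n) K ⧸ I) (Localization.Away g)]
    have := congrArg (fun f => f (algebraMap K _ k)) hφ₀
    exact this.trans (ψ.commutes k)
  let t₀ : Fin d → K := fun i => φ₀ (algebraMap (MvPolynomial (Fin d) K) _ (MvPolynomial.X i))
  let a₀ := φ₀ P.x
  have hφ₀t : φ₀.comp (algebraMap (MvPolynomial (Fin d) K) _) = MvPolynomial.eval t₀ := by
    refine MvPolynomial.ringHom_ext (fun k => ?_) (fun i => ?_)
    · rw [MvPolynomial.eval_C, RingHom.comp_apply, ← MvPolynomial.algebraMap_eq,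
        ← IsScalarTower.algebraMap_apply K (MvPolynomial (Fin d) K) (Localization.Away g), hφ₀C]
    · simp [t₀]
  have hform := hom_formula P.x t₀ φ₀ hφ₀t
  have hf0 : (P.f.map (MvPolynomial.eval t₀)).eval a₀ = 0 := by
    rw [← hform, P.hasMap.1, map_zero]
  have hf1 : (P.f.derivative.map (MvPolynomial.eval t₀)).eval a₀ ≠ 0 := by
    rw [← hform]
    exact (P.hasMap.isUnit_derivative_f.map φ₀).ne_zero
  have hg1 : (P.g.map (MvPolynomial.eval t₀)).eval a₀ ≠ 0 := by
    rw [← hform]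
    exact (P.hasMap.2.map φ₀).ne_zero
  have hd : 0 < d := by
    rcases Nat.eq_zero_or_pos d with rfl | h
    · exact (dim_zero_absurd g hg0 hdim φ₀ ψ hφ₀).elim
    · exact h
  choose p m hpm using fun i => P.exists_mul_aeval_x_g_pow_eq_aeval_x
    (algebraMap _ (Localization.Away g) (Ideal.Quotient.mk I (MvPolynomial.X i)))
  let Y : (Fin d → K) × K → Fin n → K := fun z i =>
    ((p i).map (MvPolynomial.eval z.1)).eval z.2 / ((P.g.map (MvPolynomial.eval z.1)).eval z.2) ^ m i
  have hY : ∀ (t : Fin d → K) (φ : Localization.Away g →+* K)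
      (_ : φ.comp (algebraMap _ _) = MvPolynomial.eval t)
      (_ : (P.g.map (MvPolynomial.eval t)).eval (φ P.x) ≠ 0),
      ∀ i, φ (algebraMap _ _ (Ideal.Quotient.mk I (MvPolynomial.X i))) = Y (t, φ P.x) i := by
    intro t φ hφ hne i
    have h := congrArg φ (hpm i)
    rw [map_mul, map_pow, hom_formula P.x t φ hφ, hom_formula P.x t φ hφ] at h
    exact eq_div_of_mul_eq (pow_ne_zero _ hne) h
  have hYx : Y (t₀, a₀) = x := by
    funext i
    rw [← hY t₀ φ₀ hφ₀t hg1 i, ← hψX i]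
    exact congrArg (fun f => f (Ideal.Quotient.mk I (MvPolynomial.X i))) hφ₀
  have hYc : ContinuousAt Y (t₀, a₀) := by
    rw [continuousAt_pi]
    intro i
    exact (continuous_eval₂ (p i)).continuousAt.div
      ((continuous_eval₂ P.g).pow _).continuousAt (pow_ne_zero _ hg1)
  have hev : ∀ᶠ z in 𝓝 (t₀, a₀), Y z ∈ U ∧ (P.g.map (MvPolynomial.eval z.1)).eval z.2 ≠ 0 := by
    refine Filter.Eventually.and ?_ ((continuous_eval₂ P.g).continuousAt.eventually_ne hg1)
    apply hYc
    rw [hYx]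
    exact hU.mem_nhds hxU
  rw [nhds_prod_eq] at hev
  obtain ⟨T, hT, W, hW, hTW⟩ := Filter.mem_prod_iff.1 hev
  have himp := implicit_aux P.f t₀ a₀ hf0 hf1 W hW
  have hTe : ∀ᶠ t in 𝓝 t₀, t ∈ T := hT
  have hne := nhdsNE hnontriv
  let c : K → (Fin d → K) := fun s => Function.update t₀ ⟨0, hd⟩ (t₀ ⟨0, hd⟩ + s)
  have hc : Tendsto c (𝓝[≠] 0) (𝓝 t₀) := by
    have h1 : Continuous c := continuous_const.update _ (continuous_const.add continuous_id)
    have h2 : c 0 = t₀ := by simp [c]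
    have h3 := h1.tendsto 0
    rw [h2] at h3
    exact h3.mono_left nhdsWithin_le_nhds
  obtain ⟨s, ⟨⟨a, haW, ha⟩, hsT⟩, hs0⟩ :=
    ((hc.eventually (himp.and hTe)).and eventually_mem_nhdsWithin).exists
  have hz := hTW (Set.mk_mem_prod hsT haW)
  obtain ⟨hzU, hzg⟩ : Y (c s, a) ∈ U ∧ (P.g.map (MvPolynomial.eval (c s))).eval a ≠ 0 := hz
  obtain ⟨φ, hφ, hφa⟩ := exists_hom P (c s) a ha hzg
  have hYφ := hY (c s) φ hφ (by rw [hφa]; exact hzg)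
  rw [hφa] at hYφ
  have hφK : ∀ k, φ (algebraMap K _ k) = k := by
    intro k
    rw [IsScalarTower.algebraMap_apply K (MvPolynomial (Fin d) K) (Localization.Away g),
      ← RingHom.comp_apply, hφ, MvPolynomial.algebraMap_eq, MvPolynomial.eval_C]
  have hcomp : (φ.comp (algebraMap _ _)).comp (Ideal.Quotient.mk I) =
      MvPolynomial.eval (Y (c s, a)) := by
    refine MvPolynomial.ringHom_ext (fun k => ?_) (fun i => ?_)
    · rw [MvPolynomial.eval_C]
      refine Eq.trans ?_ (hφK k)
      rw [IsScalarTower.algebraMap_apply K (MvPolynomial (Fin n) K ⧸ I) (Localization.Away g)]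
      rfl
    · rw [MvPolynomial.eval_X, ← hYφ i]
      rfl
  refine ⟨Y (c s, a), hzU, fun q hq => ?_, fun heq => ?_⟩
  · rw [← hcomp, RingHom.comp_apply, Ideal.Quotient.eq_zero_iff_mem.2 hq, map_zero]
  · have h1 : φ.comp (algebraMap (MvPolynomial (Fin n) K ⧸ I) _) =
        φ₀.comp (algebraMap (MvPolynomial (Fin n) K ⧸ I) (Localization.Away g)) := by
      rw [hφ₀]
      refine Ideal.Quotient.ringHom_ext ?_
      rw [hcomp, heq]
      refine MvPolynomial.ringHom_ext (fun k => ?_) (fun i => ?_)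
      · rw [MvPolynomial.eval_C]
        exact (ψ.commutes k).symm
      · rw [MvPolynomial.eval_X]
        exact (hψX i).symm
    have h2 : φ = φ₀ := IsLocalization.ringHom_ext (Submonoid.powers g) h1
    have h3 : c s ⟨0, hd⟩ = t₀ ⟨0, hd⟩ := by
      rw [h2] at hφ
      have := hφ.symm.trans hφ₀t
      have := congrArg (fun f => f (MvPolynomial.X ⟨0, hd⟩)) this
      simpa using this
    simp [c] at h3
    exact hs0 h3
end
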